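/- arXiv:1708.02783 — 2 statements merged into one kernel-verified Lean document; each statement's English description precedes it below -/
import Mathlib

section
/- For all n ≥ 1 and k ≥ 0, the free part of the integral Lie algebra homology H_k(𝔫𝔦𝔩_n; ℤ) is isomorphic to ℤ^{T(n,k)}, where T(n,k) is the Mahonian number, i.e. the number of permutations of {1,…,n} having exactly k inversions. Equivalently, the rank of H_k(𝔫𝔦𝔩_n; ℤ) equals |{π ∈ S_n : |{(i,j) : i < j, π(i) > π(j)}| = k}|. -/
namespace Nil

/-- Index pairs `(a,b)` with `a < b` in `Fin n`, indexing the basis `e_{ab}` of `nil_n`. -/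
abbrev P (n : ℕ) : Type := {p : Fin n × Fin n // p.1 < p.2}

/-- Lexicographic key of a pair. -/
def key {n : ℕ} (p : P n) : ℕ := p.1.1.1 * n + p.1.2.1

/-- Position (0-based) of `a` in the lexicographically sorted list of `M`. -/
def pos {n : ℕ} (M : Finset (P n)) (a : P n) : ℕ :=
  (M.filter fun b => key b < key a).card

/-- Basis of the degree `k` part of the Chevalley-Eilenberg complex `Λ^* nil_n`:
subsets `M` of pairs with `|M| = k` (empty for `k < 0`). -/
abbrev B (n : ℕ) (k : ℤ) : Type := {M : Finset (P n) // (M.card : ℤ) = k}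

/-- Degree `k` chain group of the Chevalley-Eilenberg complex of `nil_n`. -/
abbrev C (n : ℕ) (k : ℤ) : Type := B n k →₀ ℤ

/-- The Chevalley-Eilenberg boundary of a basis wedge `e_M`:
`∂(e_{a₁b₁} ∧ … ∧ e_{aₖbₖ}) = Σ_{i<j} (-1)^{i+j} [e_{aᵢbᵢ}, e_{aⱼbⱼ}] ∧ …` (omitting
the i-th and j-th factors), written in the lexicographically sorted basis.
For lexicographically sorted wedges the only nonzero brackets come from pairs
`a = (x,y)`, `b = (y,z)`, producing `±e_{(x,z)}`. -/
noncomputable def dAux {n : ℕ} (k : ℤ) (M : Finset (P n)) : C n k :=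
  ∑ a ∈ M, ∑ b ∈ M,
    if hab : a.1.2 = b.1.1 then
      (let c : P n := ⟨(a.1.1, b.1.2), lt_trans a.2 (by rw [hab]; exact b.2)⟩
       let M' : Finset (P n) := insert c ((M.erase a).erase b)
       if h' : (M'.card : ℤ) = k then
         ((-1 : ℤ) ^ (pos M a + pos M b + pos M' c)) • Finsupp.single (⟨M', h'⟩ : B n k) 1
       else 0)
    else 0

/-- The Chevalley-Eilenberg boundary map in degree `k+1`. -/
noncomputable def d (n : ℕ) (k : ℤ) : C n (k + 1) →ₗ[ℤ] C n k :=
  Finsupp.lsum ℤ fun M => LinearMap.toSpanSingleton ℤ (C n k) (dAux k M.1)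

/-- Degree-cast isomorphism. -/
noncomputable def castC (n : ℕ) {k l : ℤ} (h : k = l) : C n k ≃ₗ[ℤ] C n l :=
  Finsupp.domLCongr (Equiv.subtypeEquivRight fun _ => by rw [h])

/-- The boundary map out of degree `k`. -/
noncomputable def dFrom (n : ℕ) (k : ℤ) : C n k →ₗ[ℤ] C n (k - 1) :=
  (d n (k - 1)).comp (castC n (by ring : k = k - 1 + 1)).toLinearMap

/-- Cycles of `Λ^* nil_n` in degree `k`. -/
noncomputable def Zfull (n : ℕ) (k : ℤ) : Submodule ℤ (C n k) := LinearMap.ker (dFrom n k)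

noncomputable def HnilSub (n : ℕ) (k : ℤ) : Submodule ℤ (Zfull n k) :=
  Submodule.comap (Zfull n k).subtype (LinearMap.range (d n k) ⊓ Zfull n k)

/-- `H_k(nil_n; ℤ)`: the `k`-th integral homology of the Chevalley-Eilenberg complex
of the Lie ring of strictly upper triangular `n × n` integer matrices. -/
noncomputable def Hnil (n : ℕ) (k : ℤ) : Type := Zfull n k ⧸ HnilSub n k

noncomputable instance (n : ℕ) (k : ℤ) : AddCommGroup (Hnil n k) :=
  inferInstanceAs (AddCommGroup (Zfull n k ⧸ HnilSub n k))

noncomputable instance (n : ℕ) (k : ℤ) : Module ℤ (Hnil n k) :=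
  inferInstanceAs (Module ℤ (Zfull n k ⧸ HnilSub n k))

/-- The modified weight of a basis wedge `e_M` (indices of `Fin n` are 0-based, so the
`i`-th weight of the paper, `1 ≤ i ≤ n`, is `wt M ⟨i-1,_⟩`):
`w_i(e_M) = i - #{x : (x,i) ∈ M} + #{y : (i,y) ∈ M}`. -/
def wt {n : ℕ} (M : Finset (P n)) : Fin n → ℤ := fun i =>
  ((i.1 : ℤ) + 1) - (M.filter fun p => p.1.2 = i).card + (M.filter fun p => p.1.1 = i).card

/-- Basis wedges of degree `k` and modified weight `w`. -/
abbrev Bw (n : ℕ) (k : ℤ) (w : Fin n → ℤ) : Type :=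
  {M : Finset (P n) // (M.card : ℤ) = k ∧ wt M = w}

/-- Degree `k` part of the weight summand `⟦w⟧` of `Λ^* nil_n`. -/
abbrev Cw (n : ℕ) (k : ℤ) (w : Fin n → ℤ) : Type := Bw n k w →₀ ℤ

/-- Inclusion of the weight summand. -/
noncomputable def inclW (n : ℕ) (k : ℤ) (w : Fin n → ℤ) : Cw n k w →ₗ[ℤ] C n k :=
  Finsupp.lmapDomain ℤ ℤ fun M => (⟨M.1, M.2.1⟩ : B n k)

/-- Projection onto the weight summand. -/
noncomputable def projW (n : ℕ) (k : ℤ) (w : Fin n → ℤ) : C n k →ₗ[ℤ] Cw n k w :=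
  Finsupp.lsum ℤ fun M =>
    if h : wt M.1 = w then
      LinearMap.toSpanSingleton ℤ (Cw n k w) (Finsupp.single (⟨M.1, M.2, h⟩ : Bw n k w) 1)
    else 0

/-- The boundary of the weight summand `⟦w⟧` (the boundary preserves weights, so this
is the restriction of the Chevalley-Eilenberg boundary). -/
noncomputable def dW (n : ℕ) (k : ℤ) (w : Fin n → ℤ) : Cw n (k + 1) w →ₗ[ℤ] Cw n k w :=
  (projW n k w) ∘ₗ (d n k) ∘ₗ (inclW n (k + 1) w)

noncomputable def castCw (n : ℕ) (w : Fin n → ℤ) {k l : ℤ} (h : k = l) :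
    Cw n k w ≃ₗ[ℤ] Cw n l w :=
  Finsupp.domLCongr (Equiv.subtypeEquivRight fun _ => by rw [h])

noncomputable def dFromW (n : ℕ) (k : ℤ) (w : Fin n → ℤ) : Cw n k w →ₗ[ℤ] Cw n (k - 1) w :=
  (dW n (k - 1) w).comp (castCw n w (by ring : k = k - 1 + 1)).toLinearMap

noncomputable def ZW (n : ℕ) (k : ℤ) (w : Fin n → ℤ) : Submodule ℤ (Cw n k w) :=
  LinearMap.ker (dFromW n k w)

noncomputable def HwSub (n : ℕ) (k : ℤ) (w : Fin n → ℤ) : Submodule ℤ (ZW n k w) :=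
  Submodule.comap (ZW n k w).subtype (LinearMap.range (dW n k w) ⊓ ZW n k w)

/-- `H_k⟦w⟧`: the `k`-th homology of the weight summand `⟦w⟧` of `Λ^* nil_n`. -/
noncomputable def Hw (n : ℕ) (k : ℤ) (w : Fin n → ℤ) : Type := ZW n k w ⧸ HwSub n k w

noncomputable instance (n : ℕ) (k : ℤ) (w : Fin n → ℤ) : AddCommGroup (Hw n k w) :=
  inferInstanceAs (AddCommGroup (ZW n k w ⧸ HwSub n k w))

noncomputable instance (n : ℕ) (k : ℤ) (w : Fin n → ℤ) : Module ℤ (Hw n k w) :=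
  inferInstanceAs (Module ℤ (ZW n k w ⧸ HwSub n k w))

/-- `w ∈ 𝒮_n`: all entries lie in `{1,…,n}` and they add up to `binom (n+1) 2`. -/
def Sn (n : ℕ) (w : Fin n → ℤ) : Prop :=
  (∀ i, 1 ≤ w i ∧ w i ≤ (n : ℤ)) ∧ 2 * ∑ i, w i = (n : ℤ) * ((n : ℤ) + 1)

/-- Number of inversions of a permutation of `Fin n`. -/
def invCount (n : ℕ) (π : Equiv.Perm (Fin n)) : ℕ :=
  (Finset.univ.filter fun p : Fin n × Fin n => p.1 < p.2 ∧ π p.2 < π p.1).card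

/-- The weight sequence `(π(1), …, π(n))` attached to a permutation (1-based values). -/
def permWt (n : ℕ) (π : Equiv.Perm (Fin n)) : Fin n → ℤ := fun i => ((π i).1 : ℤ) + 1

/-- The set of inversions of a permutation, as a set of index pairs. -/
def invFinset {n : ℕ} (π : Equiv.Perm (Fin n)) : Finset (P n) :=
  Finset.univ.filter fun p => π p.1.2 < π p.1.1

/-- Index reversal `i ↦ n+1-i` (0-based: `i ↦ n-1-i`). -/
def rev {n : ℕ} (i : Fin n) : Fin n := ⟨n - 1 - i.1, by have := i.isLt; omega⟩

section Algebra

variable {R : Type*} [Ring R] {n : ℕ} (E I : Fin n → Fin n → R)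

/-- The boundary, as an element of an algebra with creation operators `E` and annihilation
operators `I`. -/
def bdry : R := ∑ x, ∑ y, ∑ z, E x z * I x y * I y z

/-- The formal adjoint of `bdry`. -/
def cobdry : R := ∑ x, ∑ y, ∑ z, E y z * E x y * I x z

/-- Canonical anticommutation relations for operators indexed by the pairs `a < b`. -/
structure IsCAR : Prop where
  EE : ∀ a b c d, E a b * E c d = -(E c d * E a b)
  II : ∀ a b c d, I a b * I c d = -(I c d * I a b)
  IE : ∀ a b c d, I a b * E c d = (if a < b ∧ a = c ∧ b = d then 1 else 0) - E c d * I a b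
  E0 : ∀ a b, ¬ a < b → E a b = 0
  I0 : ∀ a b, ¬ a < b → I a b = 0

variable {E I}

theorem IsCAR.bdry_E (h : IsCAR E I) {i j : Fin n} (hij : i < j) :
    bdry E I * E i j + E i j * bdry E I = ∑ x, E x j * I x i - ∑ z, E i z * I j z := by
  have key : ∀ x y z, E x z * I x y * I y z * E i j + E i j * (E x z * I x y * I y z) =
      (if y = i then if z = j then E x z * I x y else 0 else 0) -
        (if x = i then if y = j then E x z * I y z else 0 else 0) := by
    intro x y z
    have e1 : E x z * I x y * I y z * E i j + E i j * (E x z * I x y * I y z) =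
        E x z * I x y * (if y < z ∧ y = i ∧ z = j then 1 else 0) -
        E x z * (if x < y ∧ x = i ∧ y = j then 1 else 0) * I y z := by
      rw [mul_assoc, h.IE y z i j, mul_sub, ← mul_assoc _ (E i j),
        mul_assoc (E x z) (I x y) (E i j), h.IE x y i j,
        ← mul_assoc (E i j), ← mul_assoc (E i j), h.EE i j x z]
      noncomm_ring
    rw [e1]
    congr 1
    · by_cases h1 : y = i
      · by_cases h2 : z = j
        · subst h1 h2; simp [hij]
        · simp [h2]
      · simp [h1]
    · by_cases h1 : x = i
      · by_cases h2 : y = j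
        · subst h1 h2; simp [hij]
        · simp [h2]
      · simp [h1]
  simp only [bdry, Finset.sum_mul, Finset.mul_sum, ← Finset.sum_add_distrib, key,
    Finset.sum_sub_distrib]
  congr 1
  · refine Finset.sum_congr rfl fun x _ => ?_
    simp [Finset.sum_ite_eq']
  · rw [Finset.sum_eq_single i]
    · rw [Finset.sum_eq_single j]
      · simp
      · intro b _ hb; simp [hb]
      · simp
    · intro b _ hb; simp [hb]
    · simp

theorem IsCAR.bdry_I (h : IsCAR E I) (i j : Fin n) :
    bdry E I * I i j + I i j * bdry E I = ∑ y, I i y * I y j := by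
  have key : ∀ x y z, E x z * I x y * I y z * I i j + I i j * (E x z * I x y * I y z) =
      if x = i then if z = j then I x y * I y z else 0 else 0 := by
    intro x y z
    have e1 : E x z * I x y * I y z * I i j + I i j * (E x z * I x y * I y z) =
        (if i < j ∧ i = x ∧ j = z then 1 else 0) * (I x y * I y z) := by
      rw [← mul_assoc (I i j), ← mul_assoc (I i j), h.IE i j x z, mul_assoc _ (I y z),
        h.II y z i j, sub_mul, sub_mul, mul_assoc (E x z) (I i j), h.II i j x y]
      noncomm_ring
    rw [e1]
    by_cases h1 : x = i
    · by_cases h2 : z = j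
      · subst h1 h2
        by_cases hxz : x < z
        · simp [hxz]
        · by_cases hxy : x < y
          · have : ¬ y < z := fun hh => hxz (hxy.trans hh)
            simp [h.I0 y z this]
          · simp [h.I0 x y hxy]
      · simp [h2, Ne.symm h2]
    · simp [h1, Ne.symm h1]
  simp only [bdry, Finset.sum_mul, Finset.mul_sum, ← Finset.sum_add_distrib, key]
  rw [Finset.sum_eq_single i]
  · refine Finset.sum_congr rfl fun x _ => ?_
    simp
  · intro b _ hb; simp [hb]
  · simp

theorem IsCAR.bdry_sq (h : IsCAR E I) : bdry E I * bdry E I + bdry E I * bdry E I = 0 := by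
  set D := bdry E I with hD
  have key : ∀ x y z, D * (E x z * I x y * I y z) + E x z * I x y * I y z * D =
      ∑ u, E u z * I u x * I x y * I y z - ∑ w, E x w * I x y * I y z * I z w
      - ∑ t, E x z * I x t * I t y * I y z + ∑ t, E x z * I x y * I y t * I t z := by
    intro x y z
    by_cases hxz : x < z
    · have h1 := h.bdry_E hxz
      have h2 := h.bdry_I x y
      have h3 := h.bdry_I y z
      rw [← hD] at h1 h2 h3
      have e1 : D * (E x z * I x y * I y z) + E x z * I x y * I y z * D =
          (D * E x z + E x z * D) * I x y * I y z - E x z * (D * I x y + I x y * D) * I y z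
          + E x z * I x y * (D * I y z + I y z * D) := by noncomm_ring
      have e2 : ∀ w, E x w * I z w * I x y * I y z = E x w * I x y * I y z * I z w := by
        intro w
        rw [mul_assoc (E x w), h.II z w x y, mul_assoc, neg_mul, mul_assoc (I x y),
          h.II z w y z]
        noncomm_ring
      rw [e1, h1, h2, h3]
      simp only [sub_mul, Finset.sum_mul, Finset.mul_sum, e2, ← mul_assoc]
    · have hz : ∀ t, I x t * I t z = 0 := by
        intro t
        by_cases hxt : x < t
        · rw [h.I0 t z fun hh => hxz (hxt.trans hh), mul_zero]
        · rw [h.I0 x t hxt, zero_mul]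
      have hE : E x z = 0 := h.E0 _ _ hxz
      simp [hE, mul_assoc, hz]
  have e : D * D + D * D = ∑ x, ∑ y, ∑ z, (D * (E x z * I x y * I y z)
      + E x z * I x y * I y z * D) := by
    simp only [Finset.sum_add_distrib, ← Finset.mul_sum, ← Finset.sum_mul]
    rfl
  rw [e]
  simp only [key, Finset.sum_add_distrib, Finset.sum_sub_distrib]
  have c1 : ∑ x, ∑ y, ∑ z, ∑ u, E u z * I u x * I x y * I y z =
      ∑ x, ∑ y, ∑ z, ∑ t, E x z * I x y * I y t * I t z := by
    calc _ = ∑ x, ∑ y, ∑ u, ∑ z, E u z * I u x * I x y * I y z :=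
          Finset.sum_congr rfl fun _ _ => Finset.sum_congr rfl fun _ _ => Finset.sum_comm
      _ = ∑ x, ∑ u, ∑ y, ∑ z, E u z * I u x * I x y * I y z :=
          Finset.sum_congr rfl fun _ _ => Finset.sum_comm
      _ = ∑ u, ∑ x, ∑ y, ∑ z, E u z * I u x * I x y * I y z := Finset.sum_comm
      _ = _ := Finset.sum_congr rfl fun _ _ => Finset.sum_congr rfl fun _ _ => Finset.sum_comm
  have c2 : ∑ x, ∑ y, ∑ z, ∑ w, E x w * I x y * I y z * I z w =
      ∑ x, ∑ y, ∑ z, ∑ t, E x z * I x y * I y t * I t z :=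
    Finset.sum_congr rfl fun _ _ => Finset.sum_congr rfl fun _ _ => Finset.sum_comm
  have c3 : ∑ x, ∑ y, ∑ z, ∑ t, E x z * I x t * I t y * I y z =
      ∑ x, ∑ y, ∑ z, ∑ t, E x z * I x y * I y t * I t z := by
    refine Finset.sum_congr rfl fun x _ => ?_
    calc _ = ∑ z, ∑ y, ∑ t, E x z * I x t * I t y * I y z := Finset.sum_comm
      _ = ∑ z, ∑ t, ∑ y, E x z * I x t * I t y * I y z :=
          Finset.sum_congr rfl fun _ _ => Finset.sum_comm
      _ = _ := Finset.sum_comm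
  rw [c1, c2, c3]
  abel

/-- The terms moving the middle index of a composable pair. -/
theorem IsCAR.sum_middle (h : IsCAR E I) :
    - (∑ x, ∑ y, ∑ z, ∑ w, if y < z then E x y * E y w * I z w * I x z else 0)
    - (∑ x, ∑ y, ∑ z, ∑ u, if x < y then E y z * E u y * I u x * I x z else 0)
    + ∑ x, ∑ y, ∑ z, ∑ t, E y z * E x y * I x t * I t z =
    ∑ x, ∑ y, ∑ z, E y z * E x y * I x y * I y z := by
  have a1 : ∑ x, ∑ y, ∑ z, ∑ w, (if y < z then E x y * E y w * I z w * I x z else 0) =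
      ∑ x, ∑ y, ∑ z, ∑ t, (if y < t then E y z * E x y * I x t * I t z else 0) := by
    refine Finset.sum_congr rfl fun x _ => Finset.sum_congr rfl fun y _ => ?_
    rw [Finset.sum_comm]
    refine Finset.sum_congr rfl fun z _ => Finset.sum_congr rfl fun t _ => ?_
    split_ifs
    · rw [h.EE x y y z, mul_assoc, h.II t z x t]
      noncomm_ring
    · rfl
  have a2 : ∑ x, ∑ y, ∑ z, ∑ u, (if x < y then E y z * E u y * I u x * I x z else 0) =
      ∑ x, ∑ y, ∑ z, ∑ t, (if t < y then E y z * E x y * I x t * I t z else 0) := by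
    calc _ = ∑ y, ∑ x, ∑ z, ∑ u, (if x < y then E y z * E u y * I u x * I x z else 0) :=
          Finset.sum_comm
      _ = ∑ y, ∑ z, ∑ x, ∑ u, (if x < y then E y z * E u y * I u x * I x z else 0) :=
          Finset.sum_congr rfl fun _ _ => Finset.sum_comm
      _ = ∑ y, ∑ z, ∑ u, ∑ x, (if x < y then E y z * E u y * I u x * I x z else 0) :=
          Finset.sum_congr rfl fun _ _ => Finset.sum_congr rfl fun _ _ => Finset.sum_comm
      _ = ∑ y, ∑ u, ∑ z, ∑ x, (if x < y then E y z * E u y * I u x * I x z else 0) :=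
          Finset.sum_congr rfl fun _ _ => Finset.sum_comm
      _ = _ := Finset.sum_comm
  rw [a1, a2]
  simp only [← Finset.sum_neg_distrib, ← Finset.sum_add_distrib, ← Finset.sum_sub_distrib]
  refine Finset.sum_congr rfl fun x _ => Finset.sum_congr rfl fun y _ =>
    Finset.sum_congr rfl fun z _ => ?_
  rw [Finset.sum_eq_single y]
  · simp
  · intro t _ ht
    rcases lt_or_gt_of_ne ht with h1 | h1
    · simp [h1, h1.not_gt]
    · simp [h1, h1.not_gt]
  · simp

/-- The terms exchanging the right endpoints of two pairs. -/
theorem IsCAR.sum_exchange (h : IsCAR E I) :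
    (∑ x, ∑ y, ∑ z, ∑ u, if y < z then E x y * E u z * I u y * I x z else 0)
    + (∑ x, ∑ y, ∑ z, ∑ w, if x < y then E y z * E x w * I y w * I x z else 0) =
    (∑ x, ∑ y, ∑ z, if y < z then E x y * E x z * I x y * I x z else 0)
    - ∑ x, ∑ y, ∑ z, if x < y then E x z * E y z * I y z * I x z else 0 := by
  have b1 : ∑ x, ∑ y, ∑ z, ∑ u, (if y < z then E x y * E u z * I u y * I x z else 0) =
      ∑ r, ∑ s, ∑ c, ∑ e, (if c < e then E r c * E s e * I s c * I r e else 0) := by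
    refine Finset.sum_congr rfl fun x _ => ?_
    calc _ = ∑ y, ∑ u, ∑ z, (if y < z then E x y * E u z * I u y * I x z else 0) :=
          Finset.sum_congr rfl fun _ _ => Finset.sum_comm
      _ = _ := Finset.sum_comm
  have b2 : ∑ x, ∑ y, ∑ z, ∑ w, (if x < y then E y z * E x w * I y w * I x z else 0) =
      - ∑ r, ∑ s, ∑ c, ∑ e, (if r < s then E r c * E s e * I s c * I r e else 0) := by
    simp only [← Finset.sum_neg_distrib]
    refine Finset.sum_congr rfl fun x _ => Finset.sum_congr rfl fun y _ => ?_
    rw [Finset.sum_comm]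
    refine Finset.sum_congr rfl fun z _ => Finset.sum_congr rfl fun t _ => ?_
    split_ifs
    · rw [h.EE y t x z]
      noncomm_ring
    · simp
  have b3 : ∑ r, ∑ s, ∑ c, ∑ e,
        (if c < e ∧ s < r then E r c * E s e * I s c * I r e else 0) =
      ∑ r, ∑ s, ∑ c, ∑ e, (if e < c ∧ r < s then E r c * E s e * I s c * I r e else 0) := by
    rw [Finset.sum_comm]
    refine Finset.sum_congr rfl fun s _ => Finset.sum_congr rfl fun r _ => ?_
    rw [Finset.sum_comm]
    refine Finset.sum_congr rfl fun e _ => Finset.sum_congr rfl fun c _ => ?_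
    split_ifs
    · rw [h.EE r c s e, mul_assoc, h.II s c r e]
      noncomm_ring
    · rfl
  have b4 : ∀ r s c e, (if c < e then E r c * E s e * I s c * I r e else 0)
      - (if r < s then E r c * E s e * I s c * I r e else 0) =
      (if s = r then if c < e then E r c * E s e * I s c * I r e else 0 else 0)
      - (if e = c then if r < s then E r c * E s e * I s c * I r e else 0 else 0)
      + ((if c < e ∧ s < r then E r c * E s e * I s c * I r e else 0)
      - (if e < c ∧ r < s then E r c * E s e * I s c * I r e else 0)) := by
    intro r s c e
    rcases lt_trichotomy r s with h1 | h1 | h1 <;> rcases lt_trichotomy c e with h2 | h2 | h2 <;>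
      simp [h1, h2, ne_of_lt, ne_of_gt, not_lt_of_gt]
  rw [b1, b2, ← sub_eq_add_neg]
  simp only [← Finset.sum_sub_distrib, b4]
  simp only [Finset.sum_sub_distrib, Finset.sum_add_distrib]
  rw [b3, sub_self, add_zero]
  refine congrArg₂ (· - ·) ?_ ?_
  · refine Finset.sum_congr rfl fun x _ => ?_
    rw [Finset.sum_eq_single x]
    · simp
    · intro b _ hb; simp [hb]
    · simp
  · refine Finset.sum_congr rfl fun x _ => Finset.sum_congr rfl fun y _ =>
      Finset.sum_congr rfl fun z _ => ?_
    simp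

theorem IsCAR.laplacian (h : IsCAR E I) :
    bdry E I * cobdry E I + cobdry E I * bdry E I =
      ∑ x, ∑ y, ∑ z, if x < y ∧ y < z then
        E x z * I x z + E y z * E x y * I x y * I y z + E x y * E x z * I x y * I x z
          - E x z * E y z * I y z * I x z else 0 := by
  set D := bdry E I with hD
  have key : ∀ x y z, D * (E y z * E x y * I x z) + E y z * E x y * I x z * D =
      (if x < y ∧ y < z then E x z * I x z else 0)
      + (∑ u, if y < z then E x y * E u z * I u y * I x z else 0)
      - (∑ w, if y < z then E x y * E y w * I z w * I x z else 0)
      - (∑ u, if x < y then E y z * E u y * I u x * I x z else 0)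
      + (∑ w, if x < y then E y z * E x w * I y w * I x z else 0)
      + ∑ t, E y z * E x y * I x t * I t z := by
    intro x y z
    by_cases hxy : x < y
    · by_cases hyz : y < z
      · have h1 := h.bdry_E hyz
        have h2 := h.bdry_E hxy
        have h3 := h.bdry_I x z
        rw [← hD] at h1 h2 h3
        have e1 : D * (E y z * E x y * I x z) + E y z * E x y * I x z * D =
            (D * E y z + E y z * D) * E x y * I x z - E y z * (D * E x y + E x y * D) * I x z
            + E y z * E x y * (D * I x z + I x z * D) := by noncomm_ring
        have e2 : ∀ u, E u z * I u y * E x y =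
            (if u = x then E x z else 0) + E x y * E u z * I u y := by
          intro u
          rw [mul_assoc, h.IE, mul_sub, ← mul_assoc (E u z), h.EE u z x y]
          by_cases hu : u = x
          · subst hu; simp [hxy]
          · simp [hu]
        have e3 : ∀ w, E y w * I z w * E x y = E x y * E y w * I z w := by
          intro w
          rw [mul_assoc, h.IE, mul_sub, ← mul_assoc (E y w), h.EE y w x y]
          have : z ≠ x := (hxy.trans hyz).ne'
          simp [this]
        rw [e1, h1, h2, h3]
        simp only [sub_mul, mul_sub, Finset.sum_mul, Finset.mul_sum, ← mul_assoc, e2, e3, add_mul,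
          Finset.sum_add_distrib, Finset.sum_ite_eq', Finset.mem_univ, hxy, hyz,
          if_true, and_self]
        abel
      · have hE : E y z = 0 := h.E0 _ _ hyz
        simp [hE, hyz]
    · have hE : E x y = 0 := h.E0 _ _ hxy
      simp [hE, hxy]
  have e : D * cobdry E I + cobdry E I * D = ∑ x, ∑ y, ∑ z, (D * (E y z * E x y * I x z)
      + E y z * E x y * I x z * D) := by
    simp only [Finset.sum_add_distrib, ← Finset.mul_sum, ← Finset.sum_mul]
    rfl
  rw [e]
  simp only [key, Finset.sum_add_distrib, Finset.sum_sub_distrib]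
  have famA := h.sum_middle
  have famB := h.sum_exchange
  have fin : ∀ x y z, (if x < y ∧ y < z then
        E x z * I x z + E y z * E x y * I x y * I y z + E x y * E x z * I x y * I x z
          - E x z * E y z * I y z * I x z else 0) =
      (if x < y ∧ y < z then E x z * I x z else 0) + E y z * E x y * I x y * I y z
      + (if y < z then E x y * E x z * I x y * I x z else 0)
      - (if x < y then E x z * E y z * I y z * I x z else 0) := by
    intro x y z
    by_cases hxy : x < y
    · by_cases hyz : y < z
      · simp [hxy, hyz]
      · simp [hyz, h.E0 y z hyz]
    · simp [hxy, h.E0 x y hxy]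
  simp only [fin, Finset.sum_add_distrib, Finset.sum_sub_distrib]
  rw [← famA, add_sub_assoc _ _ (∑ x, ∑ y, ∑ z, if x < y then E x z * E y z * I y z * I x z else 0),
    ← famB]
  abel

end Algebra

section Operators

variable {n : ℕ}

theorem key_injective : Function.Injective (key : P n → ℕ) := by
  rintro ⟨⟨a, b⟩, hab⟩ ⟨⟨c, e⟩, hce⟩ h
  simp only [key] at h
  have hn : 0 < n := a.pos
  have h1 : a.1 = c.1 := by
    have h2 : (a.1 * n + b.1) / n = (c.1 * n + e.1) / n := by rw [h]
    rwa [mul_comm, Nat.mul_add_div hn, mul_comm, Nat.mul_add_div hn, Nat.div_eq_of_lt b.2,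
      Nat.div_eq_of_lt e.2] at h2
  have h2 : b.1 = e.1 := by rw [h1] at h; omega
  have h3 := Fin.ext h1
  have h4 := Fin.ext h2
  subst h3 h4
  rfl

/-- The sign of moving `p` to its place in the wedge `e_M`. -/
def sgn (M : Finset (P n)) (p : P n) : ℤ := (-1) ^ pos M p

/-- The sign of exchanging `q` and `p`. -/
def swapSign (q p : P n) : ℤ := if key q < key p then -1 else 1

theorem sgn_insert {M : Finset (P n)} {q : P n} (h : q ∉ M) (p : P n) :
    sgn (insert q M) p = sgn M p * swapSign q p := by
  unfold sgn swapSign pos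
  rw [Finset.filter_insert]
  split_ifs with hk
  · rw [Finset.card_insert_of_notMem (by simp [h]), pow_succ]
  · simp

theorem swapSign_mul_self (q p : P n) : swapSign q p * swapSign q p = 1 := by
  unfold swapSign; split_ifs <;> simp

theorem sgn_mul_self (M : Finset (P n)) (p : P n) : sgn M p * sgn M p = 1 := by
  unfold sgn; rw [← mul_pow]; simp

theorem sgn_erase {M : Finset (P n)} {q : P n} (h : q ∈ M) (p : P n) :
    sgn (M.erase q) p = sgn M p * swapSign q p := by
  have h1 := sgn_insert (M := M.erase q) (q := q) (by simp) p
  rw [Finset.insert_erase h] at h1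
  rw [h1, mul_assoc, swapSign_mul_self, mul_one]

theorem swapSign_swap {p q : P n} (h : p ≠ q) : swapSign p q = - swapSign q p := by
  unfold swapSign
  have := key_injective.ne h
  rcases lt_or_gt_of_ne this with h1 | h1 <;> simp [h1, h1.not_gt]

/-- The ungraded Chevalley-Eilenberg complex. -/
abbrev V (n : ℕ) : Type := Finset (P n) →₀ ℤ

/-- Left multiplication by `e_p`. -/
noncomputable def create (p : P n) : Module.End ℤ (V n) :=
  Finsupp.linearCombination ℤ fun M =>
    if p ∈ M then 0 else Finsupp.single (insert p M) (sgn M p)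

/-- Contraction with `e_p`. -/
noncomputable def annih (p : P n) : Module.End ℤ (V n) :=
  Finsupp.linearCombination ℤ fun M =>
    if p ∈ M then Finsupp.single (M.erase p) (sgn M p) else 0

theorem sum_end_apply {ι : Type*} (s : Finset ι) (f : ι → Module.End ℤ (V n)) (v : V n) :
    (∑ i ∈ s, f i) v = ∑ i ∈ s, f i v :=
  LinearMap.sum_apply s f v

theorem create_single (p : P n) (M : Finset (P n)) (t : ℤ) :
    create p (Finsupp.single M t) =
      if p ∈ M then 0 else Finsupp.single (insert p M) (t * sgn M p) := by
  simp [create]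

theorem annih_single (p : P n) (M : Finset (P n)) (t : ℤ) :
    annih p (Finsupp.single M t) =
      if p ∈ M then Finsupp.single (M.erase p) (t * sgn M p) else 0 := by
  simp [annih]

theorem create_mul_create (p q : P n) : create p * create q = -(create q * create p) := by
  refine Finsupp.lhom_ext fun M t => ?_
  simp only [Module.End.mul_apply, LinearMap.neg_apply, create_single]
  by_cases hpq : p = q
  · subst hpq
    split_ifs <;>
      simp only [map_zero, create_single, Finset.mem_insert_self, if_true, neg_zero]
  by_cases hp : p ∈ M <;> by_cases hq : q ∈ M <;>
    simp only [hp, hq, if_true, if_false, map_zero, neg_zero, create_single, Finset.mem_insert,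
      hpq, Ne.symm hpq, or_true, or_self]
  rw [sgn_insert hq, sgn_insert hp, swapSign_swap hpq, Finset.insert_comm, ← Finsupp.single_neg]
  congr 1
  ring

theorem annih_mul_annih (p q : P n) : annih p * annih q = -(annih q * annih p) := by
  refine Finsupp.lhom_ext fun M t => ?_
  simp only [Module.End.mul_apply, LinearMap.neg_apply, annih_single]
  by_cases hpq : p = q
  · subst hpq
    split_ifs <;>
      simp only [map_zero, annih_single, Finset.notMem_erase, if_false, neg_zero]
  by_cases hp : p ∈ M <;> by_cases hq : q ∈ M <;>
    simp only [hp, hq, if_true, if_false, map_zero, neg_zero, annih_single, Finset.mem_erase,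
      ne_eq, hpq, Ne.symm hpq, not_false_eq_true, and_self, and_false]
  rw [sgn_erase hq, sgn_erase hp, swapSign_swap hpq, Finset.erase_right_comm, ← Finsupp.single_neg]
  congr 1
  ring

theorem annih_mul_create (p q : P n) :
    annih p * create q = (if p = q then 1 else 0) - create q * annih p := by
  refine Finsupp.lhom_ext fun M t => ?_
  simp only [Module.End.mul_apply, LinearMap.sub_apply, annih_single, create_single]
  by_cases hpq : p = q
  · subst hpq
    by_cases hp : p ∈ M
    · simp only [hp, if_true, map_zero, create_single, Finset.notMem_erase, if_false,
        Module.End.one_apply, Finset.insert_erase]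
      rw [sgn_erase hp]
      simp [swapSign, mul_assoc, sgn_mul_self]
    · simp only [hp, if_true, map_zero, annih_single, Finset.mem_insert_self, if_false,
        Module.End.one_apply, Finset.erase_insert, not_false_eq_true]
      rw [sgn_insert hp]
      simp [swapSign, mul_assoc, sgn_mul_self]
  · by_cases hp : p ∈ M <;> by_cases hq : q ∈ M <;>
      simp only [hp, hq, hpq, Ne.symm hpq, if_true, if_false, map_zero, LinearMap.zero_apply,
        annih_single, create_single, Finset.mem_insert, Finset.mem_erase, ne_eq, not_false_eq_true,
        true_and, or_true, or_false, sub_zero, and_false]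
    rw [sgn_insert hq, sgn_erase hp, swapSign_swap hpq,
      Finset.erase_insert_of_ne (Ne.symm hpq), zero_sub, ← Finsupp.single_neg]
    congr 1
    ring

/-- `create`, extended by zero to all pairs of indices. -/
noncomputable def createAt (a b : Fin n) : Module.End ℤ (V n) :=
  if h : a < b then create ⟨(a, b), h⟩ else 0

/-- `annih`, extended by zero to all pairs of indices. -/
noncomputable def annihAt (a b : Fin n) : Module.End ℤ (V n) :=
  if h : a < b then annih ⟨(a, b), h⟩ else 0

theorem isCAR : IsCAR (createAt (n := n)) annihAt where
  EE a b c d := by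
    unfold createAt
    split_ifs
    · exact create_mul_create _ _
    all_goals simp
  II a b c d := by
    unfold annihAt
    split_ifs
    · exact annih_mul_annih _ _
    all_goals simp
  IE a b c d := by
    unfold createAt annihAt
    by_cases h1 : a < b <;> by_cases h2 : c < d
    · simp only [h1, h2, dif_pos, annih_mul_create, Subtype.mk.injEq, Prod.mk.injEq, true_and]
    · have : ¬ (a = c ∧ b = d) := by rintro ⟨rfl, rfl⟩; exact h2 h1
      simp [h1, h2, this]
    · simp [h1]
    · simp [h1]
  E0 a b h := by simp [createAt, h]
  I0 a b h := by simp [annihAt, h]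

/-- The membership of the pair `(a, b)` in `M`. -/
def Has (M : Finset (P n)) (a b : Fin n) : Prop := ∃ h : a < b, (⟨(a, b), h⟩ : P n) ∈ M

theorem create_annih_single (p : P n) (M : Finset (P n)) (t : ℤ) :
    create p (annih p (Finsupp.single M t)) = if p ∈ M then Finsupp.single M t else 0 := by
  rw [annih_single]
  split_ifs with hp
  · rw [create_single, if_neg (by simp), Finset.insert_erase hp, sgn_erase hp]
    simp [swapSign, mul_assoc, sgn_mul_self]
  · simp

open Classical in
theorem number_single (a b : Fin n) (M : Finset (P n)) (t : ℤ) :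
    createAt a b (annihAt a b (Finsupp.single M t)) =
      if Has M a b then Finsupp.single M t else 0 := by
  unfold createAt annihAt Has
  by_cases h : a < b
  · simp [h, create_annih_single]
  · simp [h]

/-- The triple `x < y < z` is a directed cycle in the tournament attached to `M`. -/
def Cyclic (M : Finset (P n)) (x y z : Fin n) : Prop :=
  x < y ∧ y < z ∧ ((Has M x y ∧ Has M y z ∧ ¬ Has M x z) ∨
    (¬ Has M x y ∧ ¬ Has M y z ∧ Has M x z))

open Classical in
/-- The number of cyclic triples of the tournament attached to `M`. -/
noncomputable def cyc (M : Finset (P n)) : ℕ :=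
  ∑ x, ∑ y, ∑ z, if Cyclic M x y z then 1 else 0

theorem cyc_eq_zero_iff {M : Finset (P n)} : cyc M = 0 ↔ ∀ x y z, ¬ Cyclic M x y z := by
  simp [cyc]

theorem laplacian_single (M : Finset (P n)) (t : ℤ) :
    (bdry createAt annihAt * cobdry createAt annihAt +
      cobdry createAt annihAt * bdry createAt annihAt : Module.End ℤ (V n)) (Finsupp.single M t) =
    (cyc M : ℤ) • Finsupp.single M t := by
  classical
  rw [isCAR.laplacian]
  unfold cyc
  simp only [sum_end_apply, Nat.cast_sum, Finset.sum_smul]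
  refine Finset.sum_congr rfl fun x _ => Finset.sum_congr rfl fun y _ =>
    Finset.sum_congr rfl fun z _ => ?_
  by_cases hxyz : x < y ∧ y < z
  · have e1 : (createAt y z * createAt x y * annihAt x y * annihAt y z : Module.End ℤ (V n)) =
        (createAt y z * annihAt y z) * (createAt x y * annihAt x y) := by
      have := isCAR.IE (n := n) y z x y
      rw [if_neg (by rintro ⟨-, rfl, -⟩; exact lt_irrefl _ hxyz.1), zero_sub] at this
      rw [mul_assoc, mul_assoc, isCAR.II x y y z, mul_assoc (createAt y z),
        ← mul_assoc (annihAt y z) (createAt x y), this]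
      noncomm_ring
    have e2 : (createAt x y * createAt x z * annihAt x y * annihAt x z : Module.End ℤ (V n)) =
        -((createAt x y * annihAt x y) * (createAt x z * annihAt x z)) := by
      have := isCAR.IE (n := n) x y x z
      rw [if_neg (by rintro ⟨-, -, rfl⟩; exact lt_irrefl _ hxyz.2), zero_sub] at this
      rw [mul_assoc (createAt x y) (annihAt x y),
        ← mul_assoc (annihAt x y) (createAt x z), this]
      noncomm_ring
    have e3 : (createAt x z * createAt y z * annihAt y z * annihAt x z : Module.End ℤ (V n)) =
        (createAt x z * annihAt x z) * (createAt y z * annihAt y z) := by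
      have := isCAR.IE (n := n) x z y z
      rw [if_neg (by rintro ⟨-, rfl, -⟩; exact lt_irrefl _ hxyz.1), zero_sub] at this
      rw [mul_assoc, mul_assoc, isCAR.II y z x z, mul_assoc (createAt x z),
        ← mul_assoc (annihAt x z) (createAt y z), this]
      noncomm_ring
    rw [if_pos hxyz, e1, e2, e3]
    by_cases h1 : Has M x y <;> by_cases h2 : Has M y z <;> by_cases h3 : Has M x z <;>
      simp [number_single, Cyclic, hxyz, h1, h2, h3]
  · have : ¬ Cyclic M x y z := fun h => hxyz ⟨h.1, h.2.1⟩
    simp [hxyz, this]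

end Operators

section Permutations

variable {n : ℕ}

theorem has_invFinset (π : Equiv.Perm (Fin n)) (a b : Fin n) :
    Has (invFinset π) a b ↔ a < b ∧ π b < π a := by
  simp [Has, invFinset]

theorem cyc_invFinset (π : Equiv.Perm (Fin n)) : cyc (invFinset π) = 0 := by
  rw [cyc_eq_zero_iff]
  intro x y z
  simp only [Cyclic, has_invFinset]
  grind

theorem card_invFinset (π : Equiv.Perm (Fin n)) : (invFinset π).card = invCount n π := by
  rw [invCount, ← Finset.card_map (Function.Embedding.subtype _)]
  congr 1
  ext p
  simp [invFinset, and_comm]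

theorem invFinset_injective : Function.Injective (invFinset : Equiv.Perm (Fin n) → _) := by
  intro π σ h
  have key : ∀ i j, π i < π j → σ i < σ j := by
    intro i j hij
    have h1 := has_invFinset π i j
    have h2 := has_invFinset π j i
    rw [h, has_invFinset] at h1 h2
    have hne : i ≠ j := by rintro rfl; exact lt_irrefl _ hij
    have hne' : σ i ≠ σ j := σ.injective.ne hne
    grind
  have hm : StrictMono (π.symm.trans σ) := by
    intro i j hij
    apply key
    simpa using hij
  have := Subsingleton.elim (hm.orderIsoOfSurjective _ (π.symm.trans σ).surjective)
    (OrderIso.refl (Fin n))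
  ext i
  have h2 := congrArg (fun e : Fin n ≃o Fin n => e (π i)) this
  simp at h2
  rw [h2]

/-- The relation `i → j` in the tournament attached to `M`. -/
def Beats (M : Finset (P n)) (i j : Fin n) : Prop :=
  (i < j ∧ ¬ Has M i j) ∨ (j < i ∧ Has M j i)

theorem Beats.trans {M : Finset (P n)} (hM : cyc M = 0) {i j k : Fin n} (h1 : Beats M i j)
    (h2 : Beats M j k) : Beats M i k := by
  rw [cyc_eq_zero_iff] at hM
  have a1 := hM i j k
  have a2 := hM i k j
  have a3 := hM j i k
  have a4 := hM j k i
  have a5 := hM k i j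
  have a6 := hM k j i
  simp only [Cyclic, Beats] at *
  grind

theorem exists_invFinset_eq {M : Finset (P n)} (hM : cyc M = 0) :
    ∃ π : Equiv.Perm (Fin n), invFinset π = M := by
  classical
  have irr : ∀ i, ¬ Beats M i i := by intro i; simp [Beats]
  have tri : ∀ i j, i ≠ j → Beats M i j ∨ Beats M j i := by
    intro i j hij
    simp only [Beats]
    grind
  let p : Fin n → Fin n := fun i => ⟨(Finset.univ.filter fun j => Beats M j i).card, by
    calc _ < (Finset.univ : Finset (Fin n)).card := Finset.card_lt_card (by
            rw [Finset.filter_ssubset]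
            exact ⟨i, Finset.mem_univ _, irr i⟩)
      _ = n := by simp⟩
  have mono : ∀ i j, Beats M i j → p i < p j := by
    intro i j hij
    change (Finset.univ.filter fun x => Beats M x i).card <
      (Finset.univ.filter fun x => Beats M x j).card
    refine Finset.card_lt_card (Finset.ssubset_iff_subset_ne.2 ⟨fun x hx => ?_, fun h => ?_⟩)
    · simp only [Finset.mem_filter, Finset.mem_univ, true_and] at hx ⊢
      exact hx.trans hM hij
    · have : i ∈ Finset.univ.filter fun x => Beats M x j := by simpa using hij
      rw [← h] at this
      exact irr i (by simpa using this)
  have inj : Function.Injective p := by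
    intro i j hij
    by_contra hne
    rcases tri i j hne with h | h
    · exact (mono _ _ h).ne hij
    · exact (mono _ _ h).ne' hij
  refine ⟨Equiv.ofBijective p (Finite.injective_iff_bijective.1 inj), ?_⟩
  ext ⟨⟨a, b⟩, hab⟩
  simp only [invFinset, Finset.mem_filter, Finset.mem_univ, true_and, Equiv.ofBijective_apply]
  have hab' : a < b := hab
  have h1 : Beats M b a ↔ (⟨(a, b), hab⟩ : P n) ∈ M := by
    simp [Beats, hab', hab'.not_gt, Has]
  rw [← h1]
  refine ⟨fun h => ?_, mono _ _⟩
  rcases tri a b hab'.ne with h2 | h2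
  · exact absurd (mono _ _ h2) h.not_gt
  · exact h2

/-- Wedges of degree `k` without cyclic triples. -/
abbrev Acyclic (n : ℕ) (k : ℤ) : Type := {M : B n k // cyc M.1 = 0}

theorem card_acyclic (n k : ℕ) : Nat.card (Acyclic n k) =
    (Finset.univ.filter fun π : Equiv.Perm (Fin n) => invCount n π = k).card := by
  rw [← Fintype.card_subtype, ← Nat.card_eq_fintype_card]
  symm
  refine Nat.card_congr (Equiv.ofBijective
    (fun π => ⟨⟨invFinset π.1, by rw [card_invFinset, π.2]⟩, cyc_invFinset _⟩) ⟨?_, ?_⟩)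
  · intro π σ h
    simp only [Subtype.mk.injEq] at h
    exact Subtype.ext (invFinset_injective h)
  · rintro ⟨⟨M, hk⟩, hM⟩
    obtain ⟨π, rfl⟩ := exists_invFinset_eq hM
    exact ⟨⟨π, by rw [← card_invFinset]; exact_mod_cast hk⟩, rfl⟩

end Permutations

section Homology

variable {n : ℕ}

/-- The Chevalley-Eilenberg boundary on the ungraded complex. -/
noncomputable def D (n : ℕ) : Module.End ℤ (V n) := bdry createAt annihAt

/-- The adjoint of the Chevalley-Eilenberg boundary on the ungraded complex. -/
noncomputable def Dadj (n : ℕ) : Module.End ℤ (V n) := cobdry createAt annihAt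

/-- The diagonal operator with eigenvalues `g`. -/
noncomputable def diag (g : Finset (P n) → ℤ) : Module.End ℤ (V n) :=
  Finsupp.linearCombination ℤ fun M => Finsupp.single M (g M)

theorem diag_single (g : Finset (P n) → ℤ) (M : Finset (P n)) (t : ℤ) :
    diag g (Finsupp.single M t) = g M • Finsupp.single M t := by
  simp [diag, mul_comm]

theorem diag_apply (g : Finset (P n) → ℤ) (v : V n) (M : Finset (P n)) :
    diag g v M = g M * v M := by
  classical
  induction v using Finsupp.induction_linear with
  | zero => simp
  | add v w hv hw => simp [hv, hw, mul_add]
  | single M' t =>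
    rw [diag_single]
    by_cases h : M' = M
    · subst h; simp
    · simp [h]

theorem laplacian_apply (v : V n) :
    D n (Dadj n v) + Dadj n (D n v) = diag (fun M => (cyc M : ℤ)) v := by
  have : D n * Dadj n + Dadj n * D n = diag (fun M => (cyc M : ℤ)) :=
    Finsupp.lhom_ext fun M t => by
      rw [diag_single]
      exact laplacian_single M t
  rw [← this]
  rfl

theorem D_D_apply (v : V n) : D n (D n v) = 0 := by
  have h := LinearMap.congr_fun (isCAR (n := n)).bdry_sq v
  have h' : D n (D n v) + D n (D n v) = 0 := h
  ext M
  have := DFunLike.congr_fun h' M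
  simp only [Finsupp.add_apply, Finsupp.zero_apply] at this ⊢
  omega

theorem D_diag_cyc (v : V n) :
    D n (diag (fun M => (cyc M : ℤ)) v) = diag (fun M => (cyc M : ℤ)) (D n v) := by
  rw [← laplacian_apply, ← laplacian_apply]
  simp [D_D_apply]

theorem cyc_eq_of_D_single {M M' : Finset (P n)} {t : ℤ}
    (h : D n (Finsupp.single M t) M' ≠ 0) : cyc M' = cyc M := by
  have h1 := DFunLike.congr_fun (D_diag_cyc (Finsupp.single M t)) M'
  rw [diag_single, diag_apply, map_smul, Finsupp.smul_apply, smul_eq_mul] at h1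
  exact_mod_cast (mul_right_cancel₀ h h1).symm

theorem D_diag (g : ℕ → ℤ) (v : V n) :
    D n (diag (fun M => g (cyc M)) v) = diag (fun M => g (cyc M)) (D n v) := by
  induction v using Finsupp.induction_linear with
  | zero => simp
  | add v w hv hw => simp [hv, hw]
  | single M t =>
    ext M'
    rw [diag_single, diag_apply, map_smul, Finsupp.smul_apply, smul_eq_mul]
    by_cases h : D n (Finsupp.single M t) M' = 0
    · simp [h]
    · rw [cyc_eq_of_D_single h]

/-- The concatenation of composable pairs. -/
def comp (a b : P n) (hab : a.1.2 = b.1.1) : P n :=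
  ⟨(a.1.1, b.1.2), lt_trans a.2 (by rw [hab]; exact b.2)⟩

theorem sum_pairs {R : Type*} [AddCommMonoid R] (f : P n → R) :
    ∑ x, ∑ y, (if h : x < y then f ⟨(x, y), h⟩ else 0) = ∑ a, f a := by
  rw [← Fintype.sum_prod_type' (f := fun x y => if h : x < y then f ⟨(x, y), h⟩ else 0)]
  have h := Finset.sum_subtype (Finset.univ.filter fun p : Fin n × Fin n => p.1 < p.2)
    (F := inferInstance) (p := fun p => p.1 < p.2) (by simp) (fun p => if h : p.1 < p.2 then f ⟨p, h⟩ else 0)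
  rw [Finset.sum_filter] at h
  convert h using 1
  · refine Finset.sum_congr rfl fun p _ => ?_
    split_ifs <;> rfl
  · refine Finset.sum_congr rfl fun a _ => ?_
    rw [dif_pos a.2]

theorem D_eq_sum : D n = ∑ a : P n, ∑ b : P n,
    if hab : a.1.2 = b.1.1 then create (comp a b hab) * annih a * annih b else 0 := by
  refine Eq.trans ?_ (sum_pairs _)
  unfold D bdry
  refine Finset.sum_congr rfl fun x _ => Finset.sum_congr rfl fun y _ => ?_
  by_cases hxy : x < y
  · rw [dif_pos hxy, ← sum_pairs]
    refine Eq.trans ?_ (Finset.sum_eq_single y ?_ ?_).symm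
    · refine Finset.sum_congr rfl fun z _ => ?_
      by_cases hyz : y < z
      · simp [createAt, annihAt, hxy, hyz, hxy.trans hyz, comp]
      · simp [annihAt, hyz]
    · intro b _ hb
      simp [Ne.symm hb]
    · simp
  · simp [annihAt, hxy]

theorem key_lt_of_comp {a b : P n} (hab : a.1.2 = b.1.1) : key a < key b := by
  obtain ⟨⟨x, y⟩, hxy⟩ := a
  obtain ⟨⟨y', z⟩, hyz⟩ := b
  simp only at hab
  subst hab
  simp only [key]
  have h1 : x.1 + 1 ≤ y.1 := hxy
  have := y.2
  nlinarith [Nat.mul_le_mul_right n h1]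

theorem comp_ne_left {a b : P n} (hab : a.1.2 = b.1.1) : comp a b hab ≠ a := by
  intro h
  have h1 := congrArg (fun p : P n => p.1.2) h
  change b.1.2 = a.1.2 at h1
  exact b.2.ne (by rw [h1, hab])

theorem comp_ne_right {a b : P n} (hab : a.1.2 = b.1.1) : comp a b hab ≠ b := by
  intro h
  have h1 := congrArg (fun p : P n => p.1.1) h
  change a.1.1 = b.1.1 at h1
  exact a.2.ne (by rw [h1, hab])

theorem term_single {a b : P n} (hab : a.1.2 = b.1.1) (M : Finset (P n)) :
    create (comp a b hab) (annih a (annih b (Finsupp.single M 1))) =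
      if a ∈ M ∧ b ∈ M ∧ comp a b hab ∉ M then
        Finsupp.single (insert (comp a b hab) ((M.erase a).erase b))
          ((-1) ^ (pos M a + pos M b + pos (insert (comp a b hab) ((M.erase a).erase b))
            (comp a b hab)))
      else 0 := by
  have hk := key_lt_of_comp hab
  have hne : a ≠ b := fun h => by rw [h] at hk; exact lt_irrefl _ hk
  rw [annih_single]
  by_cases hb : b ∈ M
  · by_cases ha : a ∈ M
    · rw [if_pos hb, annih_single, if_pos (Finset.mem_erase.2 ⟨hne, ha⟩), create_single,
        Finset.erase_right_comm]
      have hc : comp a b hab ∈ (M.erase a).erase b ↔ comp a b hab ∈ M := by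
        simp [comp_ne_left, comp_ne_right]
      by_cases hcM : comp a b hab ∈ M
      · rw [if_pos (hc.2 hcM), if_neg (by tauto)]
      · rw [if_neg (mt hc.1 hcM), if_pos ⟨ha, hb, hcM⟩, sgn_erase hb]
        have h1 : sgn (insert (comp a b hab) ((M.erase a).erase b)) (comp a b hab) =
            sgn ((M.erase a).erase b) (comp a b hab) := by
          rw [sgn_insert (mt hc.1 hcM)]
          simp [swapSign]
        rw [pow_add, pow_add]
        change _ = Finsupp.single _ (sgn M a * sgn M b * sgn _ _)
        rw [h1, swapSign, if_neg hk.not_gt]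
        congr 1
        ring
    · rw [if_pos hb, annih_single, if_neg (by simp [ha]), map_zero, if_neg (by tauto)]
  · rw [if_neg hb, map_zero, map_zero, if_neg (by tauto)]

theorem D_single (M : Finset (P n)) :
    D n (Finsupp.single M 1) = ∑ a : P n, ∑ b : P n,
      if hab : a.1.2 = b.1.1 then if a ∈ M ∧ b ∈ M ∧ comp a b hab ∉ M then
        Finsupp.single (insert (comp a b hab) ((M.erase a).erase b))
          ((-1) ^ (pos M a + pos M b + pos (insert (comp a b hab) ((M.erase a).erase b))
            (comp a b hab)))
      else 0 else 0 := by
  rw [D_eq_sum]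
  simp only [sum_end_apply]
  refine Finset.sum_congr rfl fun a _ => Finset.sum_congr rfl fun b _ => ?_
  split_ifs with hab h
  · have := term_single hab M
    rw [if_pos h] at this
    exact this
  · have := term_single hab M
    rw [if_neg h] at this
    exact this
  · rfl

theorem card_comp {a b : P n} (hab : a.1.2 = b.1.1) {M : Finset (P n)} (ha : a ∈ M) (hb : b ∈ M)
    (hc : comp a b hab ∉ M) :
    (insert (comp a b hab) ((M.erase a).erase b)).card + 1 = M.card := by
  have hk := key_lt_of_comp hab
  have hne : b ≠ a := fun h => by rw [h] at hk; exact lt_irrefl _ hk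
  have h2 := Finset.card_erase_add_one (Finset.mem_erase.2 ⟨hne, hb⟩)
  have h3 := Finset.card_erase_add_one ha
  rw [Finset.card_insert_of_notMem (by simp [hc])]
  omega

theorem card_comp_of_mem {a b : P n} (hab : a.1.2 = b.1.1) {M : Finset (P n)} (ha : a ∈ M)
    (hb : b ∈ M) (hc : comp a b hab ∈ M) :
    (insert (comp a b hab) ((M.erase a).erase b)).card + 2 = M.card := by
  have hk := key_lt_of_comp hab
  have hne : b ≠ a := fun h => by rw [h] at hk; exact lt_irrefl _ hk
  have h2 := Finset.card_erase_add_one (Finset.mem_erase.2 ⟨hne, hb⟩)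
  have h3 := Finset.card_erase_add_one ha
  rw [Finset.insert_eq_of_mem (by simp [hc, comp_ne_left, comp_ne_right])]
  omega

theorem D_single_of_cyc_eq_zero {M : Finset (P n)} (hM : cyc M = 0) :
    D n (Finsupp.single M 1) = 0 := by
  rw [D_single]
  refine Finset.sum_eq_zero fun a _ => Finset.sum_eq_zero fun b _ => ?_
  split_ifs with hab h
  · exfalso
    obtain ⟨ha, hb, hc⟩ := h
    refine cyc_eq_zero_iff.1 hM a.1.1 a.1.2 b.1.2 ⟨a.2, hab ▸ b.2, Or.inl ⟨⟨a.2, ha⟩, ?_, ?_⟩⟩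
    · obtain ⟨⟨x, y⟩, hxy⟩ := a
      obtain ⟨⟨y', z⟩, hyz⟩ := b
      simp only at hab
      subst hab
      exact ⟨hyz, hb⟩
    · rintro ⟨h1, h2⟩
      exact hc h2
  · rfl
  · rfl

theorem D_eq_zero_of_acyclic {v : V n} (hv : ∀ M, cyc M ≠ 0 → v M = 0) : D n v = 0 := by
  rw [← Finsupp.sum_single v, Finsupp.sum, map_sum]
  refine Finset.sum_eq_zero fun M hM => ?_
  have : cyc M = 0 := by
    by_contra h
    exact Finsupp.mem_support_iff.1 hM (hv M h)
  rw [← Finsupp.smul_single_one, map_smul, D_single_of_cyc_eq_zero this, smul_zero]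

theorem D_apply_of_acyclic (v : V n) {M : Finset (P n)} (hM : cyc M = 0) : D n v M = 0 := by
  induction v using Finsupp.induction_linear with
  | zero => simp
  | add v w hv hw => simp [hv, hw]
  | single M' t =>
    by_contra h
    have h1 := cyc_eq_of_D_single h
    rw [← Finsupp.smul_single_one, map_smul, D_single_of_cyc_eq_zero (h1 ▸ hM)] at h
    simp at h

/-- A nonzero multiple of a cycle without acyclic components is a boundary. -/
theorem exists_D_eq_smul {v : V n} (hD : D n v = 0) (hv : ∀ M, cyc M = 0 → v M = 0) :
    ∃ m : ℤ, m ≠ 0 ∧ ∃ w, D n w = m • v := by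
  classical
  let L : ℕ := ∑ M : Finset (P n), cyc M
  let g : ℕ → ℤ := fun l => ((L.factorial / l : ℕ) : ℤ)
  refine ⟨(L.factorial : ℤ), by exact_mod_cast L.factorial_ne_zero,
    Dadj n (diag (fun M => g (cyc M)) v), ?_⟩
  have h := laplacian_apply (diag (fun M => g (cyc M)) v)
  rw [D_diag g, hD, map_zero, map_zero, add_zero] at h
  rw [h]
  ext M
  rw [diag_apply, diag_apply, Finsupp.smul_apply, smul_eq_mul, ← mul_assoc]
  by_cases hM : cyc M = 0
  · simp [hv M hM]
  · congr 1
    have h1 : cyc M ≤ L := Finset.single_le_sum (fun _ _ => Nat.zero_le _) (Finset.mem_univ M)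
    simp only [g]
    exact_mod_cast Nat.mul_div_cancel' (Nat.dvd_factorial (Nat.pos_of_ne_zero hM) h1)

/-- The inclusion of the degree `k` part. -/
noncomputable def toV (n : ℕ) (k : ℤ) : C n k →ₗ[ℤ] V n := Finsupp.lmapDomain ℤ ℤ Subtype.val

/-- The projection to the degree `k` part. -/
noncomputable def ofV (n : ℕ) (k : ℤ) : V n →ₗ[ℤ] C n k :=
  Finsupp.lcomapDomain Subtype.val Subtype.val_injective

theorem toV_single {k : ℤ} (M : B n k) (t : ℤ) :
    toV n k (Finsupp.single M t) = Finsupp.single M.1 t := by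
  simp [toV]

theorem ofV_apply {k : ℤ} (v : V n) (M : B n k) : ofV n k v M = v M.1 := rfl

theorem toV_apply {k : ℤ} (x : C n k) (M : B n k) : toV n k x M.1 = x M :=
  Finsupp.mapDomain_apply Subtype.val_injective x M

theorem ofV_toV {k : ℤ} (x : C n k) : ofV n k (toV n k x) = x := by
  ext M
  rw [ofV_apply, toV_apply]

theorem toV_apply_of_card_ne {k : ℤ} (x : C n k) {M : Finset (P n)} (h : (M.card : ℤ) ≠ k) :
    toV n k x M = 0 :=
  Finsupp.mapDomain_of_notMem_range x M (by simpa using h)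

theorem toV_d {k : ℤ} (x : C n (k + 1)) : toV n k (d n k x) = D n (toV n (k + 1) x) := by
  induction x using Finsupp.induction_linear with
  | zero => simp
  | add v w hv hw => simp [hv, hw]
  | single M t =>
    have e : d n k (Finsupp.single M t) = t • dAux k M.1 := by simp [d]
    rw [e, toV_single, ← Finsupp.smul_single_one M.1, map_smul, map_smul, D_single]
    congr 1
    have hM := M.2
    have expand : ∀ f : P n → P n → V n,
        (∀ a b, ¬ (a ∈ M.1 ∧ b ∈ M.1) → f a b = 0) →
        ∑ a, ∑ b, f a b = ∑ a ∈ M.1, ∑ b ∈ M.1, f a b := by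
      intro f hf
      rw [← Finset.sum_subset (Finset.subset_univ M.1)]
      · refine Finset.sum_congr rfl fun a _ => ?_
        rw [← Finset.sum_subset (Finset.subset_univ M.1)]
        intro b _ hb
        exact hf a b (by tauto)
      · intro a _ ha
        exact Finset.sum_eq_zero fun b _ => hf a b (by tauto)
    rw [expand]
    · simp only [dAux, map_sum]
      refine Finset.sum_congr rfl fun a ha => Finset.sum_congr rfl fun b hb => ?_
      by_cases hab : a.1.2 = b.1.1
      · rw [dif_pos hab, dif_pos hab]
        by_cases hc : comp a b hab ∈ M.1
        · have := card_comp_of_mem hab ha hb hc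
          rw [dif_neg, if_neg (by tauto), map_zero]
          change ¬ ((insert (comp a b hab) ((M.1.erase a).erase b)).card : ℤ) = k
          omega
        · have := card_comp hab ha hb hc
          rw [dif_pos, if_pos ⟨ha, hb, hc⟩, map_smul, toV_single, Finsupp.smul_single_one]
          · rfl
          change ((insert (comp a b hab) ((M.1.erase a).erase b)).card : ℤ) = k
          omega
      · rw [dif_neg hab, dif_neg hab, map_zero]
    · intro a b h
      split_ifs with h1 h2
      · exact absurd ⟨h2.1, h2.2.1⟩ h
      · rfl
      · rfl

theorem ofV_D {k : ℤ} (v : V n) : ofV n k (D n v) = d n k (ofV n (k + 1) v) := by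
  induction v using Finsupp.induction_linear with
  | zero => simp
  | add v w hv hw => simp [hv, hw]
  | single M t =>
    by_cases hM : (M.card : ℤ) = k + 1
    · have h1 : Finsupp.single M t = toV n (k + 1) (Finsupp.single ⟨M, hM⟩ t) := by
        rw [toV_single]
      rw [h1, ← toV_d, ofV_toV, ofV_toV]
    · have h1 : ofV n (k + 1) (Finsupp.single M t) = 0 := by
        ext M'
        rw [ofV_apply, Finsupp.single_apply, if_neg]
        · rfl
        · rintro rfl
          exact hM M'.2
      rw [h1, map_zero, ← Finsupp.smul_single_one, map_smul, map_smul, D_single]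
      refine smul_eq_zero_of_right _ ?_
      simp only [map_sum]
      refine Finset.sum_eq_zero fun a _ => Finset.sum_eq_zero fun b _ => ?_
      split_ifs with hab h
      · have h2 := card_comp hab h.1 h.2.1 h.2.2
        ext M'
        rw [ofV_apply, Finsupp.single_apply, if_neg]
        · rfl
        · intro h3
          have := M'.2
          rw [h3] at h2
          omega
      · simp
      · simp

theorem toV_castC {k l : ℤ} (h : k = l) (x : C n k) : toV n l (castC n h x) = toV n k x := by
  subst h
  congr 1
  ext M
  rfl

theorem mem_Zfull {k : ℤ} (x : C n k) : x ∈ Zfull n k ↔ D n (toV n k x) = 0 := by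
  rw [Zfull, LinearMap.mem_ker, dFrom, ← toV_castC (by ring : k = k - 1 + 1) x, ← toV_d]
  constructor
  · intro h
    change d n (k - 1) _ = 0 at h
    rw [LinearEquiv.coe_coe] at h
    rw [h, map_zero]
  · intro h
    have := congrArg (ofV n (k - 1)) h
    rwa [ofV_toV, map_zero] at this

/-- The coordinates of a cycle at the acyclic wedges. -/
noncomputable def acyclicCoord (n : ℕ) (k : ℤ) : Zfull n k →ₗ[ℤ] (Acyclic n k → ℤ) where
  toFun z M := z.1 M.1
  map_add' _ _ := rfl
  map_smul' _ _ := rfl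

theorem HnilSub_le_ker (n : ℕ) (k : ℤ) : HnilSub n k ≤ LinearMap.ker (acyclicCoord n k) := by
  rintro z ⟨⟨y, hy⟩, -⟩
  rw [LinearMap.mem_ker]
  ext M
  change z.1 M.1 = 0
  have hy' : d n k y = z.1 := hy
  rw [← hy', ← toV_apply, toV_d]
  exact D_apply_of_acyclic _ M.2

/-- The homology class of a cycle. -/
noncomputable def toHnil (n : ℕ) (k : ℤ) : Zfull n k →ₗ[ℤ] Hnil n k := (HnilSub n k).mkQ

theorem toHnil_surjective (n : ℕ) (k : ℤ) : Function.Surjective (toHnil n k) :=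
  (HnilSub n k).mkQ_surjective

theorem toHnil_eq_zero_iff {k : ℤ} (z : Zfull n k) : toHnil n k z = 0 ↔ z ∈ HnilSub n k :=
  Submodule.Quotient.mk_eq_zero _

/-- The map induced on homology by the coordinates at the acyclic wedges. -/
noncomputable def homologyCoord (n : ℕ) (k : ℤ) : Hnil n k →ₗ[ℤ] (Acyclic n k → ℤ) :=
  Submodule.liftQ (HnilSub n k) (acyclicCoord n k) (HnilSub_le_ker n k)

theorem homologyCoord_surjective (n : ℕ) (k : ℤ) :
    Function.Surjective (homologyCoord n k) := by
  classical
  intro f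
  let x : C n k := Finsupp.equivFunOnFinite.symm fun M => if h : cyc M.1 = 0 then f ⟨M, h⟩ else 0
  have hx : x ∈ Zfull n k := by
    rw [mem_Zfull]
    refine D_eq_zero_of_acyclic fun M hM => ?_
    by_cases hk : (M.card : ℤ) = k
    · exact (toV_apply x ⟨M, hk⟩).trans (dif_neg hM)
    · exact toV_apply_of_card_ne x hk
  refine ⟨toHnil n k ⟨x, hx⟩, ?_⟩
  ext M
  exact dif_pos M.2

theorem ker_homologyCoord (n : ℕ) (k : ℤ) :
    LinearMap.ker (homologyCoord n k) = Submodule.torsion ℤ (Hnil n k) := by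
  ext q
  obtain ⟨z, rfl⟩ := toHnil_surjective n k q
  rw [LinearMap.mem_ker, Submodule.mem_torsion_iff]
  constructor
  · intro h
    have hz : ∀ M, cyc M = 0 → toV n k z.1 M = 0 := by
      intro M hM
      by_cases hk : (M.card : ℤ) = k
      · exact (toV_apply z.1 ⟨M, hk⟩).trans (congrFun h ⟨⟨M, hk⟩, hM⟩)
      · exact toV_apply_of_card_ne _ hk
    obtain ⟨m, hm, w, hw⟩ := exists_D_eq_smul ((mem_Zfull _).1 z.2) hz
    refine ⟨⟨m, mem_nonZeroDivisors_of_ne_zero hm⟩, ?_⟩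
    change m • toHnil n k z = 0
    rw [← map_smul, toHnil_eq_zero_iff]
    refine ⟨⟨ofV n (k + 1) w, ?_⟩, (m • z).2⟩
    rw [← ofV_D, hw, map_smul, ofV_toV]
    rfl
  · rintro ⟨⟨m, hm⟩, h⟩
    have h1 := congrArg (homologyCoord n k) h
    change homologyCoord n k (m • _) = _ at h1
    rw [map_smul, map_zero] at h1
    exact (smul_eq_zero.1 h1).resolve_left (nonZeroDivisors.ne_zero hm)

end Homology

/-- Theorem 2.5(a): the free part of `H_k(nil_n; ℤ)` is `ℤ^{T(n,k)}`, where `T(n,k)` is the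
Mahonian number, i.e. the number of permutations of `{1,…,n}` with exactly `k` inversions;
equivalently the rank of `H_k(nil_n; ℤ)` is the number of such permutations. -/
theorem free_part_mahonian (n : ℕ) (hn : 1 ≤ n) (k : ℕ) :
    Nonempty ((Hnil n (k : ℤ) ⧸ Submodule.torsion ℤ (Hnil n (k : ℤ))) ≃ₗ[ℤ]
      (Fin ((Finset.univ.filter fun π : Equiv.Perm (Fin n) => invCount n π = k).card) → ℤ)) ∧
    Module.rank ℤ (Hnil n (k : ℤ)) =
      ((Finset.univ.filter fun π : Equiv.Perm (Fin n) => invCount n π = k).card : Cardinal) := by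
  have e1 : (Hnil n (k : ℤ) ⧸ Submodule.torsion ℤ (Hnil n (k : ℤ))) ≃ₗ[ℤ] (Acyclic n k → ℤ) :=
    (Submodule.quotEquivOfEq _ _ (ker_homologyCoord n k).symm).trans
      ((homologyCoord n k).quotKerEquivOfSurjective (homologyCoord_surjective n k))
  have e := e1.trans (LinearEquiv.funCongrLeft ℤ ℤ
    ((finCongr (card_acyclic n k).symm).trans (Finite.equivFin (Acyclic n k)).symm))
  refine ⟨⟨e⟩, ?_⟩
  rw [← rank_quotient_eq_of_le_torsion le_rfl, e.rank_eq, rank_fin_fun]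

end Nil
end

section
/- For every prime p and every integer m ≥ 1 with p^m ≤ n − 2, the integral homology H_*(𝔫𝔦𝔩_n; ℤ) contains p^m-torsion: there exists a degree k such that H_k(𝔫𝔦𝔩_n; ℤ) has an element of order exactly p^m. -/
namespace Nil

section Torsion

open Finset

/-- The summand of `dAux k M` coming from the pair `(a, b)`. -/
noncomputable def bracketTerm {n : ℕ} (k : ℤ) (M : Finset (P n)) (a b : P n) : C n k :=
  if hab : a.1.2 = b.1.1 then
    (let c : P n := ⟨(a.1.1, b.1.2), lt_trans a.2 (by rw [hab]; exact b.2)⟩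
     let M' : Finset (P n) := insert c ((M.erase a).erase b)
     if h' : (M'.card : ℤ) = k then
       ((-1 : ℤ) ^ (pos M a + pos M b + pos M' c)) • Finsupp.single (⟨M', h'⟩ : B n k) 1
     else 0)
  else 0

lemma dAux_eq_sum {n : ℕ} (k : ℤ) (M : Finset (P n)) :
    dAux k M = ∑ x ∈ M ×ˢ M, bracketTerm k M x.1 x.2 := by
  rw [sum_product]; rfl

lemma pair_ext_iff {n : ℕ} (p r : P n) :
    p = r ↔ p.1.1.1 = r.1.1.1 ∧ p.1.2.1 = r.1.2.1 := by
  constructor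
  · rintro rfl; simp
  · rintro ⟨h1, h2⟩; exact Subtype.ext (Prod.ext (Fin.ext h1) (Fin.ext h2))

lemma bracketTerm_eq {n : ℕ} {k : ℤ} {M V : Finset (P n)} {a b : P n} (c : P n)
    (hab : a.1.2.1 = b.1.1.1) (hc₁ : c.1.1.1 = a.1.1.1) (hc₂ : c.1.2.1 = b.1.2.1)
    (hM : insert c ((M.erase a).erase b) = V) (hV : (V.card : ℤ) = k) :
    bracketTerm k M a b =
      ((-1 : ℤ) ^ (pos M a + pos M b + pos V c)) • Finsupp.single (⟨V, hV⟩ : B n k) 1 := by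
  have hab' : a.1.2 = b.1.1 := Fin.ext hab
  have hc : c = ⟨(a.1.1, b.1.2), lt_trans a.2 (by rw [hab']; exact b.2)⟩ :=
    (pair_ext_iff _ _).2 ⟨hc₁, hc₂⟩
  subst hc
  subst hM
  simp only [bracketTerm, dif_pos hab', dif_pos hV]

lemma bracketTerm_eq_zero_of_mem {n : ℕ} {k : ℤ} {M : Finset (P n)} {a b : P n} (c : P n)
    (hc₁ : c.1.1.1 = a.1.1.1) (hc₂ : c.1.2.1 = b.1.2.1)
    (ha : a ∈ M) (hb : b ∈ M) (hc : c ∈ M) (hM : (M.card : ℤ) = k + 1) :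
    bracketTerm k M a b = 0 := by
  unfold bracketTerm
  split_ifs with hab
  · have hc' : c = ⟨(a.1.1, b.1.2), lt_trans a.2 (by rw [hab]; exact b.2)⟩ :=
      (pair_ext_iff _ _).2 ⟨hc₁, hc₂⟩
    have e := congrArg Fin.val hab
    have la : a.1.1.1 < a.1.2.1 := a.2
    have lb : b.1.1.1 < b.1.2.1 := b.2
    have hca : c ≠ a := fun h => by have := (pair_ext_iff _ _).1 h; omega
    have hcb : c ≠ b := fun h => by have := (pair_ext_iff _ _).1 h; omega
    have hba : b ≠ a := fun h => by have := (pair_ext_iff _ _).1 h; omega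
    rw [← hc']
    have hmem : c ∈ (M.erase a).erase b := by simp [hca, hcb, hc]
    have hbm : b ∈ M.erase a := by simp [hba, hb]
    have h1 := card_erase_add_one hbm
    have h2 := card_erase_add_one ha
    simp only [insert_eq_of_mem hmem]
    rw [dif_neg]
    omega
  · rfl

lemma key_lt_iff {n : ℕ} (p r : P n) :
    key p < key r ↔ p.1.1.1 < r.1.1.1 ∨ (p.1.1.1 = r.1.1.1 ∧ p.1.2.1 < r.1.2.1) := by
  have h1 := p.1.2.2
  have h2 := r.1.2.2
  unfold key
  rcases lt_trichotomy p.1.1.1 r.1.1.1 with h | h | h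
  · have : (p.1.1.1 + 1) * n ≤ r.1.1.1 * n := Nat.mul_le_mul_right _ h
    rw [add_mul] at this
    omega
  · rw [h]; omega
  · have : (r.1.1.1 + 1) * n ≤ p.1.1.1 * n := Nat.mul_le_mul_right _ h
    rw [add_mul] at this
    omega

lemma pos_insert {n : ℕ} {M : Finset (P n)} {x : P n} (hx : x ∉ M) (a : P n) :
    pos (insert x M) a = pos M a + if key x < key a then 1 else 0 := by
  unfold pos
  rw [filter_insert]
  split_ifs
  · rw [card_insert_of_notMem (by simp [hx])]
  · rfl

lemma pos_erase {n : ℕ} {M : Finset (P n)} {x : P n} (hx : x ∈ M) (a : P n) :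
    pos (M.erase x) a + (if key x < key a then 1 else 0) = pos M a := by
  conv_rhs => rw [← insert_erase hx]
  rw [pos_insert (notMem_erase x M)]

/-- The wedge of all `e_{0,i}` and `e_{i,q+1}` with `1 ≤ i ≤ q`. -/
def fullWedge (n q : ℕ) : Finset (P n) :=
  univ.filter fun p => (p.1.1.1 = 0 ∧ p.1.2.1 ≤ q) ∨ (1 ≤ p.1.1.1 ∧ p.1.2.1 = q + 1)

/-- The wedge with `e_{0,q+1}` in place of the pair `e_{0,i}`, `e_{i,q+1}`. -/
def vertexWedge (n q i : ℕ) : Finset (P n) :=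
  univ.filter fun p => (p.1.1.1 = 0 ∧ p.1.2.1 ≤ q + 1 ∧ p.1.2.1 ≠ i) ∨
    (1 ≤ p.1.1.1 ∧ p.1.1.1 ≠ i ∧ p.1.2.1 = q + 1)

/-- The wedge with `e_{0,q+1}` and `e_{t,s}` in place of `e_{0,s}` and `e_{t,q+1}`. -/
def edgeWedge (n q t s : ℕ) : Finset (P n) :=
  univ.filter fun p => (p.1.1.1 = 0 ∧ p.1.2.1 ≤ q + 1 ∧ p.1.2.1 ≠ s) ∨
    (1 ≤ p.1.1.1 ∧ p.1.1.1 ≠ t ∧ p.1.2.1 = q + 1) ∨ (p.1.1.1 = t ∧ p.1.2.1 = s)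

lemma mem_fullWedge {n q : ℕ} {p : P n} : p ∈ fullWedge n q ↔
    (p.1.1.1 = 0 ∧ p.1.2.1 ≤ q) ∨ (1 ≤ p.1.1.1 ∧ p.1.2.1 = q + 1) := by
  simp [fullWedge]

lemma mem_vertexWedge {n q i : ℕ} {p : P n} : p ∈ vertexWedge n q i ↔
    (p.1.1.1 = 0 ∧ p.1.2.1 ≤ q + 1 ∧ p.1.2.1 ≠ i) ∨
    (1 ≤ p.1.1.1 ∧ p.1.1.1 ≠ i ∧ p.1.2.1 = q + 1) := by
  simp [vertexWedge]

lemma mem_edgeWedge {n q t s : ℕ} {p : P n} : p ∈ edgeWedge n q t s ↔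
    (p.1.1.1 = 0 ∧ p.1.2.1 ≤ q + 1 ∧ p.1.2.1 ≠ s) ∨
    (1 ≤ p.1.1.1 ∧ p.1.1.1 ≠ t ∧ p.1.2.1 = q + 1) ∨ (p.1.1.1 = t ∧ p.1.2.1 = s) := by
  simp [edgeWedge]

/-- The index pair `(x, y)`. -/
def mkPair {n : ℕ} (x y : ℕ) (hxy : x < y) (hy : y < n) : P n :=
  ⟨(⟨x, hxy.trans hy⟩, ⟨y, hy⟩), hxy⟩

@[simp] lemma mkPair_fst {n x y : ℕ} (hxy : x < y) (hy : y < n) :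
    (mkPair x y hxy hy).1.1.1 = x := rfl

@[simp] lemma mkPair_snd {n x y : ℕ} (hxy : x < y) (hy : y < n) :
    (mkPair x y hxy hy).1.2.1 = y := rfl

lemma card_filter_fullWedge {n q r : ℕ} (hq : q + 1 < n) (hr : r ≤ 2 * q) (Q : P n → Prop)
    [DecidablePred Q]
    (hQ : ∀ p ∈ fullWedge n q,
      (Q p ↔ (if p.1.1.1 = 0 then p.1.2.1 - 1 else q + p.1.1.1 - 1) < r)) :
    ((fullWedge n q).filter Q).card = r := by
  rw [← card_range r]
  refine card_bij (fun p _ => if p.1.1.1 = 0 then p.1.2.1 - 1 else q + p.1.1.1 - 1) ?_ ?_ ?_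
  · intro p hp
    rw [mem_filter] at hp
    exact mem_range.2 ((hQ p hp.1).1 hp.2)
  · intro p hp p' hp' h
    rw [mem_filter] at hp hp'
    have h1 := mem_fullWedge.1 hp.1
    have h2 := mem_fullWedge.1 hp'.1
    have l1 : p.1.1.1 < p.1.2.1 := p.2
    have l2 : p'.1.1.1 < p'.1.2.1 := p'.2
    rw [pair_ext_iff]
    split_ifs at h <;> omega
  · intro j hj
    rw [mem_range] at hj
    by_cases hjq : j < q
    · have hm : mkPair 0 (j + 1) (by omega) (by omega) ∈ fullWedge n q := by
        rw [mem_fullWedge]; simp; omega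
      refine ⟨_, mem_filter.2 ⟨hm, (hQ _ hm).2 ?_⟩, ?_⟩ <;> simp [hj]
    · have hm : mkPair (j + 1 - q) (q + 1) (by omega) (by omega) ∈ fullWedge n q := by
        rw [mem_fullWedge]; simp; omega
      have h0 : ¬ (j + 1 - q = 0) := by omega
      refine ⟨_, mem_filter.2 ⟨hm, (hQ _ hm).2 ?_⟩, ?_⟩ <;>
        simp only [mkPair_fst, h0, if_false] <;> omega

lemma card_fullWedge {n q : ℕ} (hq : q + 1 < n) : (fullWedge n q).card = 2 * q := by
  rw [← card_filter_fullWedge hq le_rfl (fun _ => True), filter_true]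
  intro p hp
  rw [mem_fullWedge] at hp
  have : p.1.1.1 < p.1.2.1 := p.2
  split_ifs <;> simp <;> omega

lemma pos_fullWedge {n q x y : ℕ} (hq : q + 1 < n) (a : P n) (hx : a.1.1.1 = x)
    (hy : a.1.2.1 = y) (hyq : y ≤ q + 1) :
    pos (fullWedge n q) a = if x = 0 then y - 1 else q + x - 1 := by
  subst hx hy
  have la : a.1.1.1 < a.1.2.1 := a.2
  apply card_filter_fullWedge hq
  · split_ifs <;> omega
  · intro p hp
    rw [mem_fullWedge] at hp
    have : p.1.1.1 < p.1.2.1 := p.2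
    rw [key_lt_iff]
    split_ifs <;> omega

lemma vertexWedge_eq {n q i : ℕ} (hq : q + 1 < n) (hi : 1 ≤ i) (hiq : i ≤ q) :
    vertexWedge n q i = insert (mkPair 0 (q + 1) (by omega) hq)
      (((fullWedge n q).erase (mkPair 0 i (by omega) (by omega))).erase
        (mkPair i (q + 1) (by omega) hq)) := by
  ext p
  have : p.1.1.1 < p.1.2.1 := p.2
  simp only [mem_insert, mem_erase, ne_eq, pair_ext_iff, mem_fullWedge, mem_vertexWedge,
    mkPair_fst, mkPair_snd]
  omega

lemma edgeWedge_eq {n q t s : ℕ} (hq : q + 1 < n) (ht : 1 ≤ t) (hts : t < s) (hs : s ≤ q) :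
    edgeWedge n q t s = insert (mkPair t s hts (by omega)) (insert (mkPair 0 (q + 1) (by omega) hq)
      (((fullWedge n q).erase (mkPair 0 s (by omega) (by omega))).erase
        (mkPair t (q + 1) (by omega) hq))) := by
  ext p
  have : p.1.1.1 < p.1.2.1 := p.2
  simp only [mem_insert, mem_erase, ne_eq, pair_ext_iff, mem_fullWedge, mem_edgeWedge,
    mkPair_fst, mkPair_snd]
  omega

lemma card_vertexWedge {n q i : ℕ} (hq : q + 1 < n) (hi : 1 ≤ i) (hiq : i ≤ q) :
    ((vertexWedge n q i).card : ℤ) = 2 * q - 1 := by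
  rw [vertexWedge_eq hq hi hiq, card_insert_of_notMem, card_erase_of_mem, card_erase_of_mem,
    card_fullWedge hq]
  · omega
  all_goals
    simp only [mem_erase, ne_eq, pair_ext_iff, mem_fullWedge, mkPair_fst, mkPair_snd,
      true_and, and_true]; omega

lemma card_edgeWedge {n q t s : ℕ} (hq : q + 1 < n) (ht : 1 ≤ t) (hts : t < s) (hs : s ≤ q) :
    (edgeWedge n q t s).card = 2 * q := by
  rw [edgeWedge_eq hq ht hts hs, card_insert_of_notMem, card_insert_of_notMem, card_erase_of_mem,
    card_erase_of_mem, card_fullWedge hq]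
  · omega
  all_goals
    simp only [mem_insert, mem_erase, ne_eq, pair_ext_iff, mem_fullWedge, mkPair_fst, mkPair_snd,
      true_and, and_true]; omega

lemma pos_vertexWedge {n q i x y : ℕ} (hq : q + 1 < n) (hi : 1 ≤ i) (hiq : i ≤ q) (a : P n)
    (hx : a.1.1.1 = x) (hy : a.1.2.1 = y) (hyq : y ≤ q + 1) :
    (pos (vertexWedge n q i) a : ℤ) =
      ((if x = 0 then y - 1 else q + x : ℕ) : ℤ)
        - (if x = 0 ∧ y ≤ i then 0 else 1) - (if x ≤ i then 0 else 1) := by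
  subst hx hy
  have la : a.1.1.1 < a.1.2.1 := a.2
  rw [vertexWedge_eq hq hi hiq, pos_insert]
  · have h1 := pos_fullWedge hq a rfl rfl hyq
    have h2 := pos_erase (M := fullWedge n q) (x := mkPair 0 i (by omega) (by omega))
      (by simp only [mem_fullWedge, mkPair_fst, mkPair_snd, true_and]; omega) a
    have h3 := pos_erase (M := (fullWedge n q).erase (mkPair 0 i (by omega) (by omega)))
      (x := mkPair i (q + 1) (by omega) hq)
      (by
        simp only [mem_erase, ne_eq, pair_ext_iff, mem_fullWedge, mkPair_fst, mkPair_snd,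
          and_true]; omega) a
    simp only [key_lt_iff, mkPair_fst, mkPair_snd] at h2 h3 ⊢
    push_cast
    split_ifs at * <;> omega
  · simp only [mem_erase, ne_eq, pair_ext_iff, mem_fullWedge, mkPair_fst, mkPair_snd,
      true_and, and_true]; omega

lemma pos_edgeWedge {n q t s : ℕ} (hq : q + 1 < n) (ht : 1 ≤ t) (hts : t < s) (hs : s ≤ q)
    {x y : ℕ} (a : P n) (hx : a.1.1.1 = x) (hy : a.1.2.1 = y) (hyq : y ≤ q + 1) :
    (pos (edgeWedge n q t s) a : ℤ) =
      ((if x = 0 then y - 1 else q + x : ℕ) : ℤ)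
        - (if x = 0 ∧ y ≤ s then 0 else 1) - (if x ≤ t then 0 else 1)
        + (if x < t ∨ x = t ∧ y ≤ s then 0 else 1) := by
  subst hx hy
  have la : a.1.1.1 < a.1.2.1 := a.2
  rw [edgeWedge_eq hq ht hts hs, pos_insert, pos_insert]
  · have h1 := pos_fullWedge hq a rfl rfl hyq
    have h2 := pos_erase (M := fullWedge n q) (x := mkPair 0 s (by omega) (by omega))
      (by simp only [mem_fullWedge, mkPair_fst, mkPair_snd, true_and]; omega) a
    have h3 := pos_erase (M := (fullWedge n q).erase (mkPair 0 s (by omega) (by omega)))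
      (x := mkPair t (q + 1) (by omega) hq)
      (by
        simp only [mem_erase, ne_eq, pair_ext_iff, mem_fullWedge, mkPair_fst, mkPair_snd,
          and_true]; omega) a
    simp only [key_lt_iff, mkPair_fst, mkPair_snd] at h2 h3 ⊢
    push_cast
    split_ifs at * <;> omega
  all_goals
    simp only [mem_insert, mem_erase, ne_eq, pair_ext_iff, mem_fullWedge, mkPair_fst, mkPair_snd,
      true_and, and_true]; omega

/-- The chain of `vertexWedge n q i` (zero if `i` is out of range). -/
noncomputable def vertexChain (n q i : ℕ) : C n (2 * q - 1 : ℤ) :=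
  if h : ((vertexWedge n q i).card : ℤ) = 2 * q - 1 then
    Finsupp.single (⟨vertexWedge n q i, h⟩ : B n (2 * q - 1 : ℤ)) 1 else 0

lemma bracketTerm_eq_vertexChain {n q i : ℕ} (hq : q + 1 < n) (hi : 1 ≤ i) (hiq : i ≤ q)
    {M : Finset (P n)} {a b : P n} (c : P n)
    (hab : a.1.2.1 = b.1.1.1) (hc₁ : c.1.1.1 = a.1.1.1) (hc₂ : c.1.2.1 = b.1.2.1)
    (hM : insert c ((M.erase a).erase b) = vertexWedge n q i) :
    bracketTerm (2 * q - 1 : ℤ) M a b =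
      ((-1 : ℤ) ^ (pos M a + pos M b + pos (vertexWedge n q i) c)) • vertexChain n q i := by
  rw [bracketTerm_eq c hab hc₁ hc₂ hM (card_vertexWedge hq hi hiq), vertexChain,
    dif_pos (card_vertexWedge hq hi hiq)]

lemma dAux_fullWedge {n q : ℕ} (hq : q + 1 < n) :
    dAux (2 * q - 1 : ℤ) (fullWedge n q) = -∑ i ∈ Icc 1 q, vertexChain n q i := by
  rw [dAux_eq_sum, ← sum_neg_distrib]
  symm
  refine sum_of_injOn (fun i => if h : 1 ≤ i ∧ i ≤ q then
    (mkPair 0 i (by omega) (by omega), mkPair i (q + 1) (by omega) hq) else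
    (mkPair 0 (q + 1) (by omega) hq, mkPair 0 (q + 1) (by omega) hq)) ?_ ?_ ?_ ?_
  · intro i hi j hj hij
    simp only [coe_Icc, Set.mem_Icc] at hi hj
    simp only [hi, hj, and_self, dif_pos, Prod.mk.injEq, pair_ext_iff, mkPair_snd] at hij
    omega
  · intro i hi
    simp only [coe_Icc, Set.mem_Icc] at hi
    simp only [hi, and_self, dif_pos, coe_product, Set.mem_prod, mem_coe, mem_fullWedge,
      mkPair_fst, mkPair_snd,
      true_or, or_true]
  · rintro ⟨a, b⟩ hab hne
    have la : a.1.1.1 < a.1.2.1 := a.2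
    have lb : b.1.1.1 < b.1.2.1 := b.2
    simp only [mem_product, mem_fullWedge] at hab
    rw [bracketTerm, dif_neg]
    intro h
    have h' : a.1.2.1 = b.1.1.1 := congrArg Fin.val h
    apply hne
    refine ⟨a.1.2.1, ?_, ?_⟩
    · simp only [coe_Icc, Set.mem_Icc]; omega
    · have hr : 1 ≤ a.1.2.1 ∧ a.1.2.1 ≤ q := by omega
      simp only [hr, and_self, dif_pos, Prod.mk.injEq, pair_ext_iff, mkPair_fst, mkPair_snd,
        and_true]; omega
  · intro i hi
    rw [mem_Icc] at hi
    simp only [hi, and_self, dif_pos]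
    rw [bracketTerm_eq_vertexChain hq hi.1 hi.2 (a := mkPair 0 i (by omega) (by omega))
      (b := mkPair i (q + 1) (by omega) hq) (mkPair 0 (q + 1) (by omega) hq) rfl rfl rfl
      (vertexWedge_eq hq hi.1 hi.2).symm]
    have h1 := pos_fullWedge hq (mkPair 0 i (by omega) (by omega)) (mkPair_fst _ _)
      (mkPair_snd _ _) (by omega)
    have h2 := pos_fullWedge hq (mkPair i (q + 1) (by omega) hq) (mkPair_fst _ _)
      (mkPair_snd _ _) le_rfl
    have h3 := pos_vertexWedge hq hi.1 hi.2 (mkPair 0 (q + 1) (by omega) hq) (mkPair_fst _ _)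
      (mkPair_snd _ _) le_rfl
    rw [Odd.neg_one_pow, neg_one_smul]
    rw [Nat.odd_iff]
    split_ifs at h1 h2 h3 <;> omega

lemma dAux_edgeWedge {n q t s : ℕ} (hq : q + 1 < n) (ht : 1 ≤ t) (hts : t < s) (hs : s ≤ q) :
    dAux (2 * q - 1 : ℤ) (edgeWedge n q t s) =
      ((-1 : ℤ) ^ (q + s)) • (vertexChain n q t - vertexChain n q s) := by
  have hA : mkPair 0 t (by omega) (by omega) ∈ edgeWedge n q t s := by
    simp only [mem_edgeWedge, mkPair_fst, mkPair_snd, true_and]; omega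
  have hT : mkPair t s hts (by omega) ∈ edgeWedge n q t s := by
    simp only [mem_edgeWedge, mkPair_fst, mkPair_snd, and_true, or_true]
  have hB : mkPair s (q + 1) (by omega) hq ∈ edgeWedge n q t s := by
    simp only [mem_edgeWedge, mkPair_fst, mkPair_snd, and_true]; omega
  have hC : mkPair 0 (q + 1) (by omega) hq ∈ edgeWedge n q t s := by
    simp only [mem_edgeWedge, mkPair_fst, mkPair_snd, true_and, and_true]; omega
  rw [dAux_eq_sum, ← sum_subset (s₁ := {
    (mkPair 0 t (by omega) (by omega), mkPair t s hts (by omega)),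
    (mkPair t s hts (by omega), mkPair s (q + 1) (by omega) hq)}), sum_pair]
  · simp only
    rw [bracketTerm_eq_vertexChain (i := t) hq ht (by omega)
        (a := mkPair 0 t (by omega) (by omega)) (b := mkPair t s hts (by omega))
        (mkPair 0 s (by omega) (by omega)) rfl rfl rfl,
      bracketTerm_eq_vertexChain (i := s) hq (by omega) hs
        (a := mkPair t s hts (by omega)) (b := mkPair s (q + 1) (by omega) hq)
        (mkPair t (q + 1) (by omega) hq) rfl rfl rfl]
    · have h1 : (pos (edgeWedge n q t s) (mkPair 0 t (by omega) (by omega)) : ℤ) = t - 1 := by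
        rw [pos_edgeWedge hq ht hts hs _ (mkPair_fst _ _) (mkPair_snd _ _) (by omega)]
        split_ifs <;> omega
      have h2 : (pos (edgeWedge n q t s) (mkPair t s hts (by omega)) : ℤ) = q + t - 1 := by
        rw [pos_edgeWedge hq ht hts hs _ (mkPair_fst _ _) (mkPair_snd _ _) (by omega)]
        split_ifs <;> omega
      have h3 : (pos (edgeWedge n q t s) (mkPair s (q + 1) (by omega) hq) : ℤ) = q + s - 1 := by
        rw [pos_edgeWedge hq ht hts hs _ (mkPair_fst _ _) (mkPair_snd _ _) (by omega)]
        split_ifs <;> omega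
      have h4 : (pos (vertexWedge n q t) (mkPair 0 s (by omega) (by omega)) : ℤ) = s - 2 := by
        rw [pos_vertexWedge hq ht (by omega) _ (mkPair_fst _ _) (mkPair_snd _ _) (by omega)]
        split_ifs <;> omega
      have h5 : (pos (vertexWedge n q s) (mkPair t (q + 1) (by omega) hq) : ℤ) = q + t - 1 := by
        rw [pos_vertexWedge hq (by omega) hs _ (mkPair_fst _ _) (mkPair_snd _ _) (by omega)]
        split_ifs <;> omega
      rw [smul_sub, sub_eq_add_neg (_ • vertexChain n q t), ← neg_smul,
        show -((-1 : ℤ) ^ (q + s)) = (-1) ^ (q + s + 1) by ring]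
      refine congrArg₂ (· + ·) (congrArg (· • _) (neg_one_pow_congr ?_))
        (congrArg (· • _) (neg_one_pow_congr ?_)) <;>
      · simp only [Nat.even_iff]
        omega
    all_goals
      ext p
      have : p.1.1.1 < p.1.2.1 := p.2
      simp only [mem_insert, mem_erase, ne_eq, pair_ext_iff, mem_edgeWedge, mem_vertexWedge,
        mkPair_fst, mkPair_snd]; omega
  · simp only [ne_eq, Prod.mk.injEq, pair_ext_iff, mkPair_fst, mkPair_snd]; omega
  · intro x hx
    simp only [mem_insert, mem_singleton] at hx
    rcases hx with rfl | rfl <;> simp only [mem_product, hA, hT, hB, and_self]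
  · rintro ⟨a, b⟩ hab hne
    have la : a.1.1.1 < a.1.2.1 := a.2
    have lb : b.1.1.1 < b.1.2.1 := b.2
    by_cases h : a.1.2 = b.1.1
    · have h' : a.1.2.1 = b.1.1.1 := congrArg Fin.val h
      rw [mem_product] at hab
      have hab' := hab
      simp only [mem_edgeWedge] at hab
      simp only [mem_insert, mem_singleton, Prod.mk.injEq, pair_ext_iff, mkPair_fst,
        mkPair_snd] at hne
      refine bracketTerm_eq_zero_of_mem _ ?_ ?_ hab'.1 hab'.2 hC ?_
      · simp only [mkPair_fst]; omega
      · simp only [mkPair_snd]; omega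
      · rw [card_edgeWedge hq ht hts hs]; push_cast; ring
    · rw [bracketTerm, dif_neg h]

lemma dAux_vertexWedge {n q i : ℕ} (hq : q + 1 < n) (hi : 1 ≤ i) (hiq : i ≤ q) :
    dAux (2 * q - 1 - 1 : ℤ) (vertexWedge n q i) = 0 := by
  rw [dAux_eq_sum]
  refine sum_eq_zero ?_
  rintro ⟨a, b⟩ hab
  have la : a.1.1.1 < a.1.2.1 := a.2
  have lb : b.1.1.1 < b.1.2.1 := b.2
  by_cases h : a.1.2 = b.1.1
  · have h' : a.1.2.1 = b.1.1.1 := congrArg Fin.val h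
    rw [mem_product] at hab
    have hab' := hab
    simp only [mem_vertexWedge] at hab
    refine bracketTerm_eq_zero_of_mem (mkPair 0 (q + 1) (by omega) hq) ?_ ?_ hab'.1 hab'.2 ?_ ?_
    · simp only [mkPair_fst]; omega
    · simp only [mkPair_snd]; omega
    · simp only [mem_vertexWedge, mkPair_fst, mkPair_snd, true_and, and_true]; omega
    · rw [card_vertexWedge hq hi hiq]; ring
  · rw [bracketTerm, dif_neg h]

/-- A wedge whose boundary involves a vertex wedge is the full wedge or an edge wedge. -/
lemma eq_full_or_edge {n q i : ℕ} (hq : q + 1 < n) (hi : 1 ≤ i) (hiq : i ≤ q)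
    {M : Finset (P n)} (hM : M.card = 2 * q) {a b c : P n} (ha : a ∈ M) (hb : b ∈ M)
    (hab : a.1.2.1 = b.1.1.1) (hc₁ : c.1.1.1 = a.1.1.1) (hc₂ : c.1.2.1 = b.1.2.1)
    (hV : insert c ((M.erase a).erase b) = vertexWedge n q i) :
    M = fullWedge n q ∨ ∃ t s, 1 ≤ t ∧ t < s ∧ s ≤ q ∧ M = edgeWedge n q t s := by
  have la : a.1.1.1 < a.1.2.1 := a.2
  have lb : b.1.1.1 < b.1.2.1 := b.2
  have hba : b ≠ a := fun h => by have := (pair_ext_iff _ _).1 h; omega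
  have hcV : c ∈ vertexWedge n q i := hV ▸ mem_insert_self _ _
  have hcM : c ∉ (M.erase a).erase b := by
    intro hc
    have h1 := card_erase_add_one (show b ∈ M.erase a by simp [hba, hb])
    have h2 := card_erase_add_one ha
    have h3 := card_vertexWedge hq hi hiq
    rw [← hV, insert_eq_of_mem hc] at h3
    omega
  have hE : (M.erase a).erase b = (vertexWedge n q i).erase c := by
    rw [← hV, erase_insert hcM]
  have hMem (p : P n) : p ∈ M ↔ p = a ∨ p = b ∨ (p ≠ c ∧ p ∈ vertexWedge n q i) := by
    rw [← mem_erase, ← hE]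
    simp only [mem_erase]
    by_cases h1 : p = a
    · simp [h1, ha]
    · by_cases h2 : p = b
      · simp [h2, hb]
      · simp [h1, h2]
  have haV : a ∉ (vertexWedge n q i).erase c := by rw [← hE]; simp
  have hbV : b ∉ (vertexWedge n q i).erase c := by rw [← hE]; simp
  simp only [mem_erase, ne_eq, pair_ext_iff, mem_vertexWedge] at haV hbV
  rw [mem_vertexWedge] at hcV
  by_cases h0 : c.1.1.1 = 0
  · by_cases hN : c.1.2.1 = q + 1
    · left
      ext p
      have : p.1.1.1 < p.1.2.1 := p.2
      rw [hMem]
      simp only [ne_eq, pair_ext_iff, mem_vertexWedge, mem_fullWedge]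
      omega
    · right
      refine ⟨i, c.1.2.1, hi, by omega, by omega, ?_⟩
      ext p
      have : p.1.1.1 < p.1.2.1 := p.2
      rw [hMem]
      simp only [ne_eq, pair_ext_iff, mem_vertexWedge, mem_edgeWedge]
      omega
  · right
    refine ⟨c.1.1.1, i, by omega, by omega, hiq, ?_⟩
    ext p
    have : p.1.1.1 < p.1.2.1 := p.2
    rw [hMem]
    simp only [ne_eq, pair_ext_iff, mem_vertexWedge, mem_edgeWedge]
    omega

open Classical in
/-- The mod `q` cochain that is `1` on every vertex wedge and `0` on all other wedges. -/
noncomputable def vertexCochain (n q : ℕ) : C n (2 * q - 1 : ℤ) →ₗ[ℤ] ZMod q :=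
  Finsupp.lsum ℤ fun M => LinearMap.toSpanSingleton ℤ (ZMod q)
    (if ∃ i, 1 ≤ i ∧ i ≤ q ∧ M.1 = vertexWedge n q i then 1 else 0)

lemma vertexCochain_vertexChain {n q i : ℕ} (hq : q + 1 < n) (hi : 1 ≤ i) (hiq : i ≤ q) :
    vertexCochain n q (vertexChain n q i) = 1 := by
  rw [vertexChain, dif_pos (card_vertexWedge hq hi hiq), vertexCochain]
  have : ∃ j, 1 ≤ j ∧ j ≤ q ∧ vertexWedge n q i = vertexWedge n q j := ⟨i, hi, hiq, rfl⟩
  simp [this]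

lemma vertexCochain_dAux {n q : ℕ} (hq : q + 1 < n) {M : Finset (P n)} (hM : M.card = 2 * q) :
    vertexCochain n q (dAux (2 * q - 1 : ℤ) M) = 0 := by
  by_cases hF : M = fullWedge n q
  · rw [hF, dAux_fullWedge hq, map_neg, map_sum, sum_congr rfl fun i hi =>
      vertexCochain_vertexChain hq (mem_Icc.1 hi).1 (mem_Icc.1 hi).2]
    simp
  by_cases hE : ∃ t s, 1 ≤ t ∧ t < s ∧ s ≤ q ∧ M = edgeWedge n q t s
  · obtain ⟨t, s, ht, hts, hs, rfl⟩ := hE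
    rw [dAux_edgeWedge hq ht hts hs, map_smul, map_sub, vertexCochain_vertexChain hq ht (by omega),
      vertexCochain_vertexChain hq (by omega) hs, sub_self, smul_zero]
  rw [dAux_eq_sum, map_sum]
  refine sum_eq_zero ?_
  rintro ⟨a, b⟩ hab
  rw [mem_product] at hab
  unfold bracketTerm
  split_ifs with h
  · simp only
    split_ifs with h'
    · rw [map_smul, vertexCochain, Finsupp.lsum_single, LinearMap.toSpanSingleton_apply, if_neg,
        smul_zero, smul_zero]
      rintro ⟨i, hi, hiq, hV⟩
      rcases eq_full_or_edge hq hi hiq hM hab.1 hab.2 (congrArg Fin.val h)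
        (c := ⟨(a.1.1, b.1.2), _⟩) rfl rfl hV with h1 | h1
      · exact hF h1
      · exact hE h1
    · exact map_zero _
  · exact map_zero _

lemma d_single {n : ℕ} {k : ℤ} (M : B n (k + 1)) :
    d n k (Finsupp.single M 1) = dAux k M.1 := by
  simp [d]

lemma vertexCochain_d {n q : ℕ} (hq : q + 1 < n) (y : C n (2 * q - 1 + 1 : ℤ)) :
    vertexCochain n q (d n (2 * q - 1 : ℤ) y) = 0 := by
  suffices h : vertexCochain n q ∘ₗ d n (2 * q - 1 : ℤ) = 0 from LinearMap.congr_fun h y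
  refine Finsupp.lhom_ext' fun M => LinearMap.ext_ring ?_
  have := M.2
  simp only [LinearMap.comp_apply, Finsupp.lsingle_apply, d_single]
  exact vertexCochain_dAux hq (by omega)

lemma dAux_mem_range {n q : ℕ} {M : Finset (P n)} (hM : M.card = 2 * q) :
    dAux (2 * q - 1 : ℤ) M ∈ LinearMap.range (d n (2 * q - 1 : ℤ)) :=
  ⟨Finsupp.single ⟨M, by rw [hM]; push_cast; ring⟩ 1, d_single _⟩

lemma vertexChain_sub_mem_range {n q i : ℕ} (hq : q + 1 < n) (hi : 1 ≤ i) (hiq : i ≤ q) :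
    vertexChain n q 1 - vertexChain n q i ∈ LinearMap.range (d n (2 * q - 1 : ℤ)) := by
  rcases hi.eq_or_lt with rfl | h
  · simp
  · have h1 := dAux_mem_range (card_edgeWedge hq le_rfl h hiq)
    rw [dAux_edgeWedge hq le_rfl h hiq] at h1
    have h2 := Submodule.smul_mem _ ((-1 : ℤ) ^ (q + i)) h1
    rwa [smul_smul, ← mul_pow, neg_one_mul, neg_neg, one_pow, one_smul] at h2

lemma smul_vertexChain_mem_range {n q : ℕ} (hq : q + 1 < n) :
    q • vertexChain n q 1 ∈ LinearMap.range (d n (2 * q - 1 : ℤ)) := by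
  have h1 := dAux_mem_range (card_fullWedge hq)
  rw [dAux_fullWedge hq] at h1
  have h2 := Submodule.sum_mem (LinearMap.range (d n (2 * q - 1 : ℤ))) fun i hi =>
    vertexChain_sub_mem_range hq (mem_Icc.1 hi).1 (mem_Icc.1 hi).2
  have h3 := Submodule.sub_mem _ h2 h1
  simpa [sum_sub_distrib] using h3

lemma vertexChain_mem_Zfull {n q i : ℕ} (hq : q + 1 < n) (hi : 1 ≤ i) (hiq : i ≤ q) :
    vertexChain n q i ∈ Zfull n (2 * q - 1 : ℤ) := by
  rw [Zfull, LinearMap.mem_ker, vertexChain, dif_pos (card_vertexWedge hq hi hiq), dFrom,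
    LinearMap.comp_apply, castC, LinearEquiv.coe_coe, Finsupp.domLCongr_single, d_single]
  exact dAux_vertexWedge hq hi hiq

/-- `H_{2q-1}(nil_n)` has an element of order `q` whenever `1 ≤ q ≤ n - 2`. -/
lemma exists_addOrderOf_eq {n q : ℕ} (hq : q + 1 < n) (hq₁ : 1 ≤ q) :
    ∃ x : Hnil n (2 * q - 1 : ℤ), addOrderOf x = q := by
  let z : Zfull n (2 * q - 1 : ℤ) := ⟨vertexChain n q 1, vertexChain_mem_Zfull hq le_rfl hq₁⟩
  let x : Hnil n (2 * q - 1 : ℤ) := (HnilSub n (2 * q - 1 : ℤ)).mkQ z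
  have hx (j : ℕ) : j • x = 0 ↔
      j • vertexChain n q 1 ∈ LinearMap.range (d n (2 * q - 1 : ℤ)) := by
    have h1 : j • x = (HnilSub n (2 * q - 1 : ℤ)).mkQ (j • z) := (map_nsmul _ _ _).symm
    have h2 : j • x = 0 ↔ j • z ∈ HnilSub n (2 * q - 1 : ℤ) := by
      rw [h1]; exact Submodule.Quotient.mk_eq_zero _
    rw [h2, HnilSub, Submodule.mem_comap, Submodule.mem_inf]
    exact and_iff_left (j • z).2
  refine ⟨x, Nat.dvd_antisymm ?_ ?_⟩
  · exact addOrderOf_dvd_of_nsmul_eq_zero ((hx q).2 (smul_vertexChain_mem_range hq))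
  · obtain ⟨y, hy⟩ := (hx _).1 (addOrderOf_nsmul_eq_zero x)
    have h := vertexCochain_d hq y
    rw [hy, map_nsmul, vertexCochain_vertexChain hq le_rfl hq₁, nsmul_one] at h
    exact (ZMod.natCast_eq_zero_iff _ _).1 h

end Torsion

/-- For every prime `p` and `m ≥ 1` with `p^m ≤ n - 2`, the integral homology
`H_*(nil_n; ℤ)` contains an element of order exactly `p^m`. -/
theorem prime_power_torsion_exists (n p m : ℕ) (hp : p.Prime) (hm : 1 ≤ m)
    (h : p ^ m ≤ n - 2) :
    ∃ (k : ℤ) (x : Hnil n k), addOrderOf x = p ^ m := by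
  have hq : 1 ≤ p ^ m := Nat.one_le_pow _ _ hp.pos
  obtain ⟨x, hx⟩ := exists_addOrderOf_eq (n := n) (q := p ^ m) (by omega) hq
  exact ⟨_, x, hx⟩

end Nil
end
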